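/- There exist constants Q > 0, M > 0 and ω > 0, depending only on L, D and k₂, with the following property: if w is infinitely differentiable on an open neighborhood of [0,L]×[0,∞) and is a classical solution of the full damped inextensible cantilever system with p ≡ 0 on [0,L]×[0,T] for every T > 0, and if X(0) ≤ Q, then X(t) ≤ M·exp(−ω t) for all t ≥ 0, where X(t) = X₀(t) + X₁(t) + X₂(t) + X₃(t). -/

import Mathlib

open MeasureTheory Set

/-- Spatial partial derivative of a function of `(x, t)`. -/
noncomputable def pdx (f : ℝ → ℝ → ℝ) : ℝ → ℝ → ℝ := fun x t => deriv (fun y => f y t) x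

/-- Temporal partial derivative of a function of `(x, t)`. -/
noncomputable def pdt (f : ℝ → ℝ → ℝ) : ℝ → ℝ → ℝ := fun x t => deriv (fun s => f x s) t

/-- Axial displacement from the effective inextensibility constraint:
`u(x,t) = -(1/2)∫₀ˣ w_x(ξ,t)² dξ`. -/
noncomputable def uF (w : ℝ → ℝ → ℝ) : ℝ → ℝ → ℝ := fun x t =>
  -(1/2) * ∫ ξ in (0:ℝ)..x, (pdx w ξ t) ^ 2

/-- `u_t(x,t) = -∫₀ˣ w_x w_xt dξ`. -/
noncomputable def utF (w : ℝ → ℝ → ℝ) : ℝ → ℝ → ℝ := fun x t =>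
  -∫ ξ in (0:ℝ)..x, pdx w ξ t * pdt (pdx w) ξ t

/-- `u_tt(x,t) = -∫₀ˣ [w_xt² + w_x w_xtt] dξ`. -/
noncomputable def uttF (w : ℝ → ℝ → ℝ) : ℝ → ℝ → ℝ := fun x t =>
  -∫ ξ in (0:ℝ)..x, ((pdt (pdx w) ξ t) ^ 2 + pdx w ξ t * pdt (pdt (pdx w)) ξ t)

/-- A classical solution of the full damped inextensible cantilever system on
`[0,L] × [0,T]` with forcing `p`: smooth on an open neighborhood of `[0,L] × [0,T]`,
satisfying the PDE
`w_tt + D ∂ₓ⁴w + k₂ ∂ₓ⁴w_t − D ∂ₓ(w_xx² w_x) + D ∂ₓ²(w_x² w_xx) + ∂ₓ(w_x ∫ₓᴸ u_tt dξ) = p`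
pointwise and the clamped-free boundary conditions. -/
def IsFullSol (L D k2 T : ℝ) (p w : ℝ → ℝ → ℝ) : Prop :=
  (∃ U : Set (ℝ × ℝ), IsOpen U ∧ Icc (0:ℝ) L ×ˢ Icc (0:ℝ) T ⊆ U ∧
      ContDiffOn ℝ (⊤ : ℕ∞) (fun q : ℝ × ℝ => w q.1 q.2) U) ∧
  (∀ x ∈ Icc (0:ℝ) L, ∀ t ∈ Icc (0:ℝ) T,
      pdt (pdt w) x t + D * pdx (pdx (pdx (pdx w))) x t
        + k2 * pdx (pdx (pdx (pdx (pdt w)))) x t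
        - D * pdx (fun y s => (pdx (pdx w) y s) ^ 2 * pdx w y s) x t
        + D * pdx (pdx (fun y s => (pdx w y s) ^ 2 * pdx (pdx w) y s)) x t
        + pdx (fun y s => pdx w y s * ∫ ξ in y..L, uttF w ξ s) x t
      = p x t) ∧
  (∀ t ∈ Icc (0:ℝ) T,
    w 0 t = 0 ∧ pdx w 0 t = 0 ∧ pdx (pdx w) L t = 0 ∧ pdx (pdx (pdx w)) L t = 0)

/-- `u_xxt = -(w_xx w_xt + w_x w_xxt)` (closed pointwise form). -/
noncomputable def uxxtF (w : ℝ → ℝ → ℝ) : ℝ → ℝ → ℝ := fun x t =>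
  -(pdx (pdx w) x t * pdt (pdx w) x t + pdx w x t * pdt (pdx (pdx w)) x t)

/-- `u_ttt(x,t) = -∫₀ˣ [3 w_xt w_xtt + w_x w_xttt] dξ`. -/
noncomputable def utttF (w : ℝ → ℝ → ℝ) : ℝ → ℝ → ℝ := fun x t =>
  -∫ ξ in (0:ℝ)..x,
    (3 * pdt (pdx w) ξ t * pdt (pdt (pdx w)) ξ t
      + pdx w ξ t * pdt (pdt (pdt (pdx w))) ξ t)

/-- Level-zero energy `X₀(t) = ‖w_t‖² + ‖w_xx‖² + ‖w_x w_xx‖² + ‖u_t‖²`. -/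
noncomputable def X0 (L : ℝ) (w : ℝ → ℝ → ℝ) (t : ℝ) : ℝ :=
  (∫ x in (0:ℝ)..L, (pdt w x t) ^ 2)
    + (∫ x in (0:ℝ)..L, (pdx (pdx w) x t) ^ 2)
    + (∫ x in (0:ℝ)..L, (pdx w x t * pdx (pdx w) x t) ^ 2)
    + (∫ x in (0:ℝ)..L, (utF w x t) ^ 2)

/-- Level-one energy `X₁(t) = ‖w_tt‖² + ‖w_xxt‖² + ‖w_xt w_xx‖² + ‖w_x w_xxt‖² + ‖u_tt‖²`. -/
noncomputable def X1 (L : ℝ) (w : ℝ → ℝ → ℝ) (t : ℝ) : ℝ :=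
  (∫ x in (0:ℝ)..L, (pdt (pdt w) x t) ^ 2)
    + (∫ x in (0:ℝ)..L, (pdt (pdx (pdx w)) x t) ^ 2)
    + (∫ x in (0:ℝ)..L, (pdt (pdx w) x t * pdx (pdx w) x t) ^ 2)
    + (∫ x in (0:ℝ)..L, (pdx w x t * pdt (pdx (pdx w)) x t) ^ 2)
    + (∫ x in (0:ℝ)..L, (uttF w x t) ^ 2)

/-- Level-two energy `X₂(t) = ‖w_xxt‖² + ‖∂ₓ⁴w‖² + ‖w_x ∂ₓ⁴w‖² + ‖u_xxt‖²`. -/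
noncomputable def X2 (L : ℝ) (w : ℝ → ℝ → ℝ) (t : ℝ) : ℝ :=
  (∫ x in (0:ℝ)..L, (pdt (pdx (pdx w)) x t) ^ 2)
    + (∫ x in (0:ℝ)..L, (pdx (pdx (pdx (pdx w))) x t) ^ 2)
    + (∫ x in (0:ℝ)..L, (pdx w x t * pdx (pdx (pdx (pdx w))) x t) ^ 2)
    + (∫ x in (0:ℝ)..L, (uxxtF w x t) ^ 2)

/-- Level-three energy
`X₃(t) = ‖w_ttt‖² + ‖w_xxtt‖² + ‖w_x w_xxtt‖² + ‖w_xx w_xtt‖² + ‖u_ttt‖²`. -/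
noncomputable def X3 (L : ℝ) (w : ℝ → ℝ → ℝ) (t : ℝ) : ℝ :=
  (∫ x in (0:ℝ)..L, (pdt (pdt (pdt w)) x t) ^ 2)
    + (∫ x in (0:ℝ)..L, (pdt (pdt (pdx (pdx w))) x t) ^ 2)
    + (∫ x in (0:ℝ)..L, (pdx w x t * pdt (pdt (pdx (pdx w))) x t) ^ 2)
    + (∫ x in (0:ℝ)..L, (pdx (pdx w) x t * pdt (pdt (pdx w)) x t) ^ 2)
    + (∫ x in (0:ℝ)..L, (utttF w x t) ^ 2)

section
open scoped ContDiff Topology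

/-- Jointly smooth functions on the plane. -/
def Sm (f : ℝ → ℝ → ℝ) : Prop := ContDiff ℝ ∞ (fun q : ℝ × ℝ => f q.1 q.2)

namespace Sm

theorem cont {f : ℝ → ℝ → ℝ} (hf : Sm f) : Continuous (fun q : ℝ × ℝ => f q.1 q.2) :=
  ContDiff.continuous hf

theorem contx {f : ℝ → ℝ → ℝ} (hf : Sm f) (t : ℝ) : Continuous (fun x => f x t) :=
  hf.cont.comp (by fun_prop : Continuous fun x : ℝ => (x, t))

theorem contt {f : ℝ → ℝ → ℝ} (hf : Sm f) (x : ℝ) : Continuous (fun t => f x t) :=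
  hf.cont.comp (by fun_prop : Continuous fun t : ℝ => (x, t))

theorem dx_aux {f : ℝ → ℝ → ℝ} (hf : Sm f) (x t : ℝ) :
    HasDerivAt (fun y => f y t) (fderiv ℝ (fun q : ℝ × ℝ => f q.1 q.2) (x, t) (1, 0)) x := by
  have h1 : HasFDerivAt (fun q : ℝ × ℝ => f q.1 q.2)
      (fderiv ℝ (fun q : ℝ × ℝ => f q.1 q.2) (x, t)) (x, t) :=
    (ContDiff.differentiable hf (by simp) _).hasFDerivAt
  have h2 : HasDerivAt (fun y : ℝ => (y, t)) ((1 : ℝ), (0 : ℝ)) x :=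
    (hasDerivAt_id x).prodMk (hasDerivAt_const x t)
  exact h1.comp_hasDerivAt x h2

theorem dt_aux {f : ℝ → ℝ → ℝ} (hf : Sm f) (x t : ℝ) :
    HasDerivAt (fun s => f x s) (fderiv ℝ (fun q : ℝ × ℝ => f q.1 q.2) (x, t) (0, 1)) t := by
  have h1 : HasFDerivAt (fun q : ℝ × ℝ => f q.1 q.2)
      (fderiv ℝ (fun q : ℝ × ℝ => f q.1 q.2) (x, t)) (x, t) :=
    (ContDiff.differentiable hf (by simp) _).hasFDerivAt
  have h2 : HasDerivAt (fun s : ℝ => (x, s)) ((0 : ℝ), (1 : ℝ)) t :=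
    (hasDerivAt_const t x).prodMk (hasDerivAt_id t)
  exact h1.comp_hasDerivAt t h2

theorem pdx_eq {f : ℝ → ℝ → ℝ} (hf : Sm f) :
    pdx f = fun x t => fderiv ℝ (fun q : ℝ × ℝ => f q.1 q.2) (x, t) (1, 0) := by
  funext x t; exact (hf.dx_aux x t).deriv

theorem pdt_eq {f : ℝ → ℝ → ℝ} (hf : Sm f) :
    pdt f = fun x t => fderiv ℝ (fun q : ℝ × ℝ => f q.1 q.2) (x, t) (0, 1) := by
  funext x t; exact (hf.dt_aux x t).deriv

theorem dx {f : ℝ → ℝ → ℝ} (hf : Sm f) (x t : ℝ) :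
    HasDerivAt (fun y => f y t) (pdx f x t) x := by
  rw [hf.pdx_eq]; exact hf.dx_aux x t

theorem dt {f : ℝ → ℝ → ℝ} (hf : Sm f) (x t : ℝ) :
    HasDerivAt (fun s => f x s) (pdt f x t) t := by
  rw [hf.pdt_eq]; exact hf.dt_aux x t

theorem fder {f : ℝ → ℝ → ℝ} (hf : Sm f) :
    ContDiff ℝ ∞ (fderiv ℝ (fun q : ℝ × ℝ => f q.1 q.2)) :=
  (contDiff_infty_iff_fderiv.1 hf).2

theorem pdx {f : ℝ → ℝ → ℝ} (hf : Sm f) : Sm (pdx f) := by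
  rw [hf.pdx_eq]
  exact hf.fder.clm_apply contDiff_const

theorem pdt {f : ℝ → ℝ → ℝ} (hf : Sm f) : Sm (pdt f) := by
  rw [hf.pdt_eq]
  exact hf.fder.clm_apply contDiff_const

theorem comm {f : ℝ → ℝ → ℝ} (hf : Sm f) : _root_.pdx (_root_.pdt f) = _root_.pdt (_root_.pdx f) := by
  have hsymm : ∀ q v w, fderiv ℝ (fderiv ℝ (fun q : ℝ × ℝ => f q.1 q.2)) q v w
      = fderiv ℝ (fderiv ℝ (fun q : ℝ × ℝ => f q.1 q.2)) q w v := by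
    intro q v w
    exact second_derivative_symmetric
      (f' := fderiv ℝ (fun q : ℝ × ℝ => f q.1 q.2))
      (fun y => (ContDiff.differentiable hf (by simp) y).hasFDerivAt)
      ((hf.fder.differentiable (by simp) q).hasFDerivAt) v w
  funext x t
  have hd := (hf.fder.differentiable (by simp) (x, t)).hasFDerivAt
  rw [hf.pdt.pdx_eq, hf.pdx.pdt_eq]
  have e1 : (fun q : ℝ × ℝ => _root_.pdt f q.1 q.2) = fun q =>
      fderiv ℝ (fun q : ℝ × ℝ => f q.1 q.2) q (0, 1) := by rw [hf.pdt_eq]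
  have e2 : (fun q : ℝ × ℝ => _root_.pdx f q.1 q.2) = fun q =>
      fderiv ℝ (fun q : ℝ × ℝ => f q.1 q.2) q (1, 0) := by rw [hf.pdx_eq]
  simp only [e1, e2]
  rw [(hd.clm_apply (hasFDerivAt_const ((0 : ℝ), (1 : ℝ)) (x, t))).fderiv,
    (hd.clm_apply (hasFDerivAt_const ((1 : ℝ), (0 : ℝ)) (x, t))).fderiv]
  simp [hsymm _ (1, 0) (0, 1)]

theorem add {f g : ℝ → ℝ → ℝ} (hf : Sm f) (hg : Sm g) : Sm (fun x t => f x t + g x t) :=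
  ContDiff.add hf hg
theorem sub {f g : ℝ → ℝ → ℝ} (hf : Sm f) (hg : Sm g) : Sm (fun x t => f x t - g x t) :=
  ContDiff.sub hf hg
theorem mul {f g : ℝ → ℝ → ℝ} (hf : Sm f) (hg : Sm g) : Sm (fun x t => f x t * g x t) :=
  ContDiff.mul hf hg
theorem neg {f : ℝ → ℝ → ℝ} (hf : Sm f) : Sm (fun x t => - f x t) :=
  ContDiff.neg hf
theorem pow {f : ℝ → ℝ → ℝ} (hf : Sm f) (n : ℕ) : Sm (fun x t => (f x t) ^ n) :=
  ContDiff.pow hf n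
theorem const (c : ℝ) : Sm (fun _ _ => c) := contDiff_const
theorem cmul {f : ℝ → ℝ → ℝ} (c : ℝ) (hf : Sm f) : Sm (fun x t => c * f x t) :=
  (const c).mul hf

end Sm

/-- Spatial primitive from `0`. -/
noncomputable def Jp (f : ℝ → ℝ → ℝ) : ℝ → ℝ → ℝ := fun x t => ∫ ξ in (0:ℝ)..x, f ξ t

theorem Jp_cont {f : ℝ → ℝ → ℝ} (hf : Continuous (fun q : ℝ × ℝ => f q.1 q.2)) :
    Continuous (fun q : ℝ × ℝ => Jp f q.1 q.2) := by
  have h : Continuous (Function.uncurry (fun (t x : ℝ) => f x t)) :=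
    hf.comp continuous_swap
  have := intervalIntegral.continuous_parametric_primitive_of_continuous (μ := volume)
    (a₀ := (0:ℝ)) h
  exact this.comp continuous_swap

theorem hasDerivAt_param {f f' : ℝ → ℝ → ℝ} (hf : Continuous (fun q : ℝ × ℝ => f q.1 q.2))
    (hf' : Continuous (fun q : ℝ × ℝ => f' q.1 q.2))
    (hd : ∀ x t, HasDerivAt (fun s => f x s) (f' x t) t) (a b t : ℝ) :
    HasDerivAt (fun s => ∫ x in a..b, f x s) (∫ x in a..b, f' x t) t := by
  have hK : IsCompact ((uIcc a b) ×ˢ (Icc (t-1) (t+1))) := isCompact_uIcc.prod isCompact_Icc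
  obtain ⟨C, hC⟩ := hK.exists_bound_of_continuousOn hf'.continuousOn
  have hx : ∀ s, Continuous (fun x => f x s) := fun s => hf.comp (by fun_prop : Continuous fun x : ℝ => (x, s))
  have hx' : ∀ s, Continuous (fun x => f' x s) := fun s => hf'.comp (by fun_prop : Continuous fun x : ℝ => (x, s))
  refine (intervalIntegral.hasDerivAt_integral_of_dominated_loc_of_deriv_le (μ := volume)
    (F := fun s x => f x s) (F' := fun s x => f' x s) (s := Icc (t-1) (t+1)) (bound := fun _ => C)
    (Icc_mem_nhds (by linarith) (by linarith)) ?_ ?_ ?_ ?_ ?_ ?_).2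
  · exact Filter.Eventually.of_forall fun s => (hx s).aestronglyMeasurable
  · exact (hx t).intervalIntegrable _ _
  · exact (hx' t).aestronglyMeasurable
  · refine Filter.Eventually.of_forall fun x hxm s hs => hC (x, s) ⟨uIoc_subset_uIcc hxm, hs⟩
  · exact intervalIntegrable_const
  · exact Filter.Eventually.of_forall fun x _ s _ => hd x s

theorem Jp_dx {f : ℝ → ℝ → ℝ} (hf : Continuous (fun q : ℝ × ℝ => f q.1 q.2)) (x t : ℝ) :
    HasDerivAt (fun y => Jp f y t) (f x t) x := by
  have hx : Continuous (fun x => f x t) := hf.comp (by fun_prop : Continuous fun x : ℝ => (x, t))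
  exact intervalIntegral.integral_hasDerivAt_right (hx.intervalIntegrable _ _)
    (hx.stronglyMeasurableAtFilter _ _) hx.continuousAt

theorem Jp_contDiff (n : ℕ) : ∀ {f : ℝ → ℝ → ℝ}, Sm f →
    ContDiff ℝ n (fun q : ℝ × ℝ => Jp f q.1 q.2) := by
  induction n with
  | zero => intro f hf; simpa using Jp_cont hf.cont
  | succ n ih =>
    intro f hf
    push_cast
    rw [contDiff_succ_iff_hasFDerivAt]
    have hspan : ∀ c : ℝ, ContinuousLinearMap.toSpanSingleton ℝ c = c • (1 : ℝ →L[ℝ] ℝ) := by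
      intro c; ext; simp
    let f1 : ℝ → ℝ → ℝ →L[ℝ] ℝ := fun x t => f x t • (1 : ℝ →L[ℝ] ℝ)
    let f2 : ℝ → ℝ → ℝ →L[ℝ] ℝ := fun x t => Jp (pdt f) x t • (1 : ℝ →L[ℝ] ℝ)
    have c1 : ContDiff ℝ n (fun q : ℝ × ℝ => f1 q.1 q.2) :=
      (ContDiff.of_le hf (by exact_mod_cast le_top)).smul contDiff_const
    have c2 : ContDiff ℝ n (fun q : ℝ × ℝ => f2 q.1 q.2) := (ih hf.pdt).smul contDiff_const
    refine ⟨fun q => (f1 q.1 q.2).coprod (f2 q.1 q.2), ?_, ?_⟩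
    · have h3 : (fun q : ℝ × ℝ => (f1 q.1 q.2).coprod (f2 q.1 q.2)) = fun q =>
          (f1 q.1 q.2).comp (ContinuousLinearMap.fst ℝ ℝ ℝ)
          + (f2 q.1 q.2).comp (ContinuousLinearMap.snd ℝ ℝ ℝ) := by
        funext q; ext <;> simp
      rw [h3]
      exact (c1.clm_comp contDiff_const).add (c2.clm_comp contDiff_const)
    · intro q
      refine (hasStrictFDerivAt_uncurry_coprod (𝕜 := ℝ) (u := q) (f := Jp f) (f₁ := f1) (f₂ := f2)
        ?_ ?_ ?_ ?_).hasFDerivAt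
      · refine Filter.Eventually.of_forall fun v => ?_
        have := (Jp_dx hf.cont v.1 v.2).hasFDerivAt
        rw [hspan] at this
        exact this
      · refine Filter.Eventually.of_forall fun v => ?_
        have := (hasDerivAt_param hf.cont hf.pdt.cont hf.dt 0 v.1 v.2).hasFDerivAt
        rw [hspan] at this
        exact this
      · exact c1.continuous.continuousAt
      · exact c2.continuous.continuousAt

namespace Sm

theorem J {f : ℝ → ℝ → ℝ} (hf : Sm f) : Sm (Jp f) := by
  unfold Sm
  rw [contDiff_infty]
  intro n
  exact Jp_contDiff n hf

theorem pdx_J {f : ℝ → ℝ → ℝ} (hf : Sm f) : _root_.pdx (Jp f) = f := by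
  funext x t; exact (Jp_dx hf.cont x t).deriv

theorem pdt_J {f : ℝ → ℝ → ℝ} (hf : Sm f) : _root_.pdt (Jp f) = Jp (_root_.pdt f) := by
  funext x t; exact (hasDerivAt_param hf.cont hf.pdt.cont hf.dt 0 x t).deriv

theorem int_dt {f : ℝ → ℝ → ℝ} (hf : Sm f) (a b t : ℝ) :
    HasDerivAt (fun s => ∫ x in a..b, f x s) (∫ x in a..b, _root_.pdt f x t) t :=
  hasDerivAt_param hf.cont hf.pdt.cont hf.dt a b t

end Sm

/-- `L²(0,L)` norm. -/
noncomputable def nn (L : ℝ) (f : ℝ → ℝ) : ℝ := Real.sqrt (∫ x in (0:ℝ)..L, (f x) ^ 2)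

theorem nn_sq {L : ℝ} (hL : 0 < L) (f : ℝ → ℝ) : (nn L f) ^ 2 = ∫ x in (0:ℝ)..L, (f x) ^ 2 :=
  Real.sq_sqrt (intervalIntegral.integral_nonneg hL.le fun _ _ => sq_nonneg _)

theorem nn_nonneg (L : ℝ) (f : ℝ → ℝ) : 0 ≤ nn L f := Real.sqrt_nonneg _

/-- The `L¹` norm is bounded by `√L` times the `L²` norm. -/
theorem int_abs_le {L : ℝ} (hL : 0 < L) {f : ℝ → ℝ} (hf : Continuous f) :
    ∫ x in (0:ℝ)..L, |f x| ≤ Real.sqrt L * nn L f := by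
  set A := ∫ x in (0:ℝ)..L, |f x| with hA
  set B := ∫ x in (0:ℝ)..L, (f x) ^ 2 with hB
  have hA0 : 0 ≤ A := intervalIntegral.integral_nonneg hL.le fun _ _ => abs_nonneg _
  have key : A ^ 2 ≤ L * B := by
    have h : 0 ≤ ∫ x in (0:ℝ)..L, (L * |f x| - A) ^ 2 :=
      intervalIntegral.integral_nonneg hL.le fun _ _ => sq_nonneg _
    have h2 : ∫ x in (0:ℝ)..L, (L * |f x| - A) ^ 2
        = L ^ 2 * B - 2 * L * A * A + L * A ^ 2 := by
      have e : (fun x => (L * |f x| - A) ^ 2)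
          = fun x => (L ^ 2 * (f x) ^ 2 - 2 * L * A * |f x|) + A ^ 2 := by
        funext x; rw [← sq_abs (f x)]; ring
      rw [e, intervalIntegral.integral_add, intervalIntegral.integral_sub,
        intervalIntegral.integral_const_mul, intervalIntegral.integral_const_mul,
        intervalIntegral.integral_const]
      · simp; ring
      all_goals apply Continuous.intervalIntegrable; fun_prop
    rw [h2] at h
    have : 0 ≤ L * (L * B - A ^ 2) := by nlinarith
    have := nonneg_of_mul_nonneg_right this hL
    linarith
  have : Real.sqrt L * nn L f = Real.sqrt (L * B) := by
    rw [nn, Real.sqrt_mul hL.le]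
  rw [this]
  exact Real.le_sqrt_of_sq_le key

/-- Pointwise bound of a function vanishing somewhere by the `L¹` norm of its derivative. -/
theorem sup_le_int {L : ℝ} {p q : ℝ → ℝ} (hq : Continuous q)
    (hd : ∀ x, HasDerivAt p (q x) x) {c : ℝ} (hc : c ∈ Icc (0:ℝ) L) (hpc : p c = 0)
    {x : ℝ} (hx : x ∈ Icc (0:ℝ) L) : |p x| ≤ ∫ x in (0:ℝ)..L, |q x| := by
  have h1 : p x = ∫ y in c..x, q y := by
    rw [intervalIntegral.integral_eq_sub_of_hasDerivAt (fun y _ => hd y)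
      (hq.intervalIntegrable _ _), hpc, sub_zero]
  have h2 : |∫ y in c..x, q y| ≤ |(∫ y in c..x, |q y|)| :=
    intervalIntegral.norm_integral_le_abs_integral_norm (f := q)
  have hqI : ∀ a b, IntervalIntegrable (fun y => |q y|) volume a b := fun a b =>
    hq.abs.intervalIntegrable _ _
  have hL : 0 ≤ L := hc.1.trans hc.2
  rw [h1]
  refine h2.trans ?_
  rcases le_total c x with h | h
  · rw [abs_of_nonneg (intervalIntegral.integral_nonneg h fun _ _ => abs_nonneg _)]
    exact intervalIntegral.integral_mono_interval hc.1 h hx.2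
      (Filter.Eventually.of_forall fun y => abs_nonneg (q y)) (hqI _ _)
  · rw [intervalIntegral.integral_symm, abs_neg,
      abs_of_nonneg (intervalIntegral.integral_nonneg h fun _ _ => abs_nonneg _)]
    exact intervalIntegral.integral_mono_interval hx.1 h hc.2
      (Filter.Eventually.of_forall fun y => abs_nonneg (q y)) (hqI _ _)

theorem sup_le_nn {L : ℝ} (hL : 0 < L) {p q : ℝ → ℝ} (hq : Continuous q)
    (hd : ∀ x, HasDerivAt p (q x) x) {c : ℝ} (hc : c ∈ Icc (0:ℝ) L) (hpc : p c = 0)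
    {x : ℝ} (hx : x ∈ Icc (0:ℝ) L) : |p x| ≤ Real.sqrt L * nn L q :=
  (sup_le_int hq hd hc hpc hx).trans (int_abs_le hL hq)

theorem int_le_const {L C : ℝ} (hL : 0 ≤ L) {f : ℝ → ℝ} (hf : Continuous f)
    (h : ∀ x ∈ Icc (0:ℝ) L, f x ≤ C) : ∫ x in (0:ℝ)..L, f x ≤ L * C := by
  have := intervalIntegral.integral_mono_on (μ := volume) hL (hf.intervalIntegrable 0 L)
    (intervalIntegrable_const (c := C)) h
  simpa using this

theorem Jp_bound {L C : ℝ} {f : ℝ → ℝ → ℝ} {t : ℝ}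
    (h : ∀ x ∈ Icc (0:ℝ) L, |f x t| ≤ C) {x : ℝ} (hx : x ∈ Icc (0:ℝ) L) :
    |Jp f x t| ≤ L * C := by
  have hC : 0 ≤ C := (abs_nonneg _).trans (h x hx)
  have := intervalIntegral.norm_integral_le_of_norm_le_const (a := 0) (b := x) (C := C)
    (f := fun ξ => f ξ t) (by
      intro y hy
      rw [uIoc_of_le hx.1] at hy
      exact h y ⟨hy.1.le, hy.2.trans hx.2⟩)
  rw [Real.norm_eq_abs, sub_zero, abs_of_nonneg hx.1] at this
  calc |Jp f x t| ≤ C * x := this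
    _ ≤ L * C := by nlinarith [hx.2]

/-- `∫ₓᴸ` of the spatial primitive. -/
noncomputable def Kp (L : ℝ) (f : ℝ → ℝ → ℝ) : ℝ → ℝ → ℝ := fun x t =>
  Jp (Jp f) L t - Jp (Jp f) x t

theorem Kp_eq (L : ℝ) {f : ℝ → ℝ → ℝ} (hf : Sm f) (x t : ℝ) :
    Kp L f x t = ∫ ξ in x..L, Jp f ξ t := by
  unfold Kp
  rw [Jp, Jp, intervalIntegral.integral_interval_sub_left] <;>
  exact (hf.J.contx t).intervalIntegrable _ _

theorem Sm.atx {f : ℝ → ℝ → ℝ} (hf : Sm f) (c : ℝ) : Sm (fun _ t => f c t) := by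
  unfold Sm at *
  exact hf.comp (contDiff_const.prodMk contDiff_snd)

theorem Sm.K (L : ℝ) {f : ℝ → ℝ → ℝ} (hf : Sm f) : Sm (Kp L f) :=
  (hf.J.J.atx L).sub hf.J.J

theorem Kp_dx (L : ℝ) {f : ℝ → ℝ → ℝ} (hf : Sm f) (x t : ℝ) :
    HasDerivAt (fun y => Kp L f y t) (-(Jp f x t)) x := by
  have := hf.J.J.dx x t
  rw [hf.J.pdx_J] at this
  exact this.const_sub _

theorem Kp_dt (L : ℝ) {f : ℝ → ℝ → ℝ} (hf : Sm f) (x t : ℝ) :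
    HasDerivAt (fun s => Kp L f x s) (Kp L (pdt f) x t) t := by
  have h1 := hf.J.J.dt x t
  have h2 := hf.J.J.dt L t
  rw [hf.J.pdt_J, hf.pdt_J] at h1 h2
  exact h2.sub h1

theorem Kp_L (L : ℝ) (f : ℝ → ℝ → ℝ) (t : ℝ) : Kp L f L t = 0 := by simp [Kp]

theorem Kp_bound {L C : ℝ} {f : ℝ → ℝ → ℝ} {t : ℝ} (hf : Sm f)
    (h : ∀ x ∈ Icc (0:ℝ) L, |f x t| ≤ C) {x : ℝ} (hx : x ∈ Icc (0:ℝ) L) :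
    |Kp L f x t| ≤ L ^ 2 * C := by
  rw [Kp_eq L hf]
  have hC : 0 ≤ C := (abs_nonneg _).trans (h x hx)
  have hL : 0 ≤ L := hx.1.trans hx.2
  have := intervalIntegral.norm_integral_le_of_norm_le_const (a := x) (b := L) (C := L * C)
    (f := fun ξ => Jp f ξ t) (by
      intro y hy
      rw [uIoc_of_le hx.2] at hy
      exact Jp_bound h ⟨hx.1.trans hy.1.le, hy.2⟩)
  rw [Real.norm_eq_abs, abs_of_nonneg (sub_nonneg.2 hx.2)] at this
  have h0 : 0 ≤ L * C := by positivity
  calc _ ≤ L * C * (L - x) := this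
    _ ≤ L ^ 2 * C := by nlinarith [hx.1]

/-- Fubini in the form used for the nonlocal inertial term. -/
theorem int_Kp {L : ℝ} {f g : ℝ → ℝ → ℝ} (hf : Sm f) (hg : Sm g) (t : ℝ) :
    ∫ x in (0:ℝ)..L, f x t * Kp L g x t = ∫ x in (0:ℝ)..L, Jp f x t * Jp g x t := by
  have h := intervalIntegral.integral_mul_deriv_eq_deriv_mul (a := 0) (b := L)
    (u := fun x => Kp L g x t) (v := fun x => Jp f x t)
    (u' := fun x => -(Jp g x t)) (v' := fun x => f x t)
    (fun x _ => Kp_dx L hg x t) (fun x _ => Jp_dx hf.cont x t)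
    ((hg.J.contx t).neg.intervalIntegrable _ _) ((hf.contx t).intervalIntegrable _ _)
  have e : Jp f 0 t = 0 := by simp [Jp]
  rw [Kp_L, e, mul_zero, zero_mul, sub_zero, zero_sub, ← intervalIntegral.integral_neg] at h
  simpa [mul_comm] using h

/-- Weak form from the strong form. -/
theorem weak_form {L : ℝ} {g m r φ : ℝ → ℝ → ℝ} (hm : Sm m) (hr : Sm r) (hφ : Sm φ)
    (t : ℝ) (hL : 0 ≤ L)
    (hpde : ∀ x ∈ Icc (0:ℝ) L, g x t + pdx (pdx m) x t - pdx r x t = 0)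
    (h1 : m L t = 0) (h2 : pdx m L t = 0) (h3 : r L t = 0)
    (h4 : φ 0 t = 0) (h5 : pdx φ 0 t = 0) :
    ∫ x in (0:ℝ)..L, (g x t * φ x t + m x t * pdx (pdx φ) x t + r x t * pdx φ x t) = 0 := by
  have hI : ∀ {f : ℝ → ℝ → ℝ}, Sm f → IntervalIntegrable (fun x => f x t) volume 0 L :=
    fun hf => (hf.contx t).intervalIntegrable _ _
  have key : ∀ x, HasDerivAt (fun y => m y t * pdx φ y t - pdx m y t * φ y t + r y t * φ y t)
      (m x t * pdx (pdx φ) x t - pdx (pdx m) x t * φ x t + (pdx r x t * φ x t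
        + r x t * pdx φ x t)) x := by
    intro x
    have := (((hm.dx x t).mul (hφ.pdx.dx x t)).sub ((hm.pdx.dx x t).mul (hφ.dx x t))).add
      ((hr.dx x t).mul (hφ.dx x t))
    exact this.congr_deriv (by ring)
  have h := intervalIntegral.integral_eq_sub_of_hasDerivAt (a := 0) (b := L) (fun x _ => key x)
    (hI (((hm.mul hφ.pdx.pdx).sub (hm.pdx.pdx.mul hφ)).add ((hr.pdx.mul hφ).add (hr.mul hφ.pdx))))
  rw [h1, h2, h3, h4, h5] at h
  simp only [zero_mul, mul_zero, sub_zero, add_zero] at h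
  refine Eq.trans ?_ h
  apply intervalIntegral.integral_congr
  intro x hx
  rw [uIcc_of_le hL] at hx
  have := hpde x hx
  have e : g x t = pdx r x t - pdx (pdx m) x t := by linarith
  simp only [e]
  ring

/-- Iterated time derivative. -/
noncomputable def Td : ℕ → (ℝ → ℝ → ℝ) → ℝ → ℝ → ℝ
  | 0, f => f
  | n + 1, f => pdt (Td n f)

theorem Td_zero (f : ℝ → ℝ → ℝ) : Td 0 f = f := rfl
theorem Td_succ (n : ℕ) (f : ℝ → ℝ → ℝ) : Td (n + 1) f = pdt (Td n f) := rfl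

theorem Sm.Td {f : ℝ → ℝ → ℝ} (hf : Sm f) (n : ℕ) : Sm (Td n f) := by
  induction n with
  | zero => exact hf
  | succ n ih => exact ih.pdt

theorem Td_pdx {f : ℝ → ℝ → ℝ} (hf : Sm f) (n : ℕ) : pdx (Td n f) = Td n (pdx f) := by
  induction n with
  | zero => rfl
  | succ n ih => rw [Td_succ, Td_succ, (hf.Td n).comm, ih]

theorem Td_dt {f : ℝ → ℝ → ℝ} (hf : Sm f) (n : ℕ) (x t : ℝ) :
    HasDerivAt (fun s => Td n f x s) (Td (n + 1) f x t) t := (hf.Td n).dt x t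

theorem Td_dx {f : ℝ → ℝ → ℝ} (hf : Sm f) (n : ℕ) (x t : ℝ) :
    HasDerivAt (fun y => Td n f y t) (Td n (pdx f) x t) x := by
  have := (hf.Td n).dx x t
  rwa [Td_pdx hf] at this

theorem Td_vanish {f : ℝ → ℝ → ℝ} {c T : ℝ} (h : ∀ t ∈ Ioo (0:ℝ) T, f c t = 0) (n : ℕ) :
    ∀ t ∈ Ioo (0:ℝ) T, Td n f c t = 0 := by
  induction n with
  | zero => exact h
  | succ n ih =>
    intro t ht
    have : (fun s => Td n f c s) =ᶠ[𝓝 t] fun _ => 0 := by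
      filter_upwards [isOpen_Ioo.mem_nhds ht] with s hs using ih s hs
    show deriv (fun s => Td n f c s) t = 0
    rw [this.deriv_eq]; simp

/-- The local part of the inertial density. -/
noncomputable def hF (w : ℝ → ℝ → ℝ) : ℝ → ℝ → ℝ := fun x t =>
  (Td 1 (pdx w) x t) ^ 2 + pdx w x t * Td 2 (pdx w) x t

/-- Bending moment. -/
noncomputable def Mf (D k : ℝ) (w : ℝ → ℝ → ℝ) : ℝ → ℝ → ℝ := fun x t =>
  D * pdx (pdx w) x t + k * Td 1 (pdx (pdx w)) x t + D * ((pdx w x t) ^ 2 * pdx (pdx w) x t)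

/-- Transverse force density. -/
noncomputable def Rf (L D : ℝ) (w : ℝ → ℝ → ℝ) : ℝ → ℝ → ℝ := fun x t =>
  D * ((pdx (pdx w) x t) ^ 2 * pdx w x t) + pdx w x t * Kp L (hF w) x t

/-- Globally smooth solutions on a time slab. -/
structure Sol (L D k T : ℝ) (w : ℝ → ℝ → ℝ) : Prop where
  sm : Sm w
  pde : ∀ x ∈ Icc (0:ℝ) L, ∀ t ∈ Ioo (0:ℝ) T,
    Td 2 w x t + pdx (pdx (Mf D k w)) x t - pdx (Rf L D w) x t = 0
  bc1 : ∀ t ∈ Ioo (0:ℝ) T, w 0 t = 0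
  bc2 : ∀ t ∈ Ioo (0:ℝ) T, pdx w 0 t = 0
  bc3 : ∀ t ∈ Ioo (0:ℝ) T, pdx (pdx w) L t = 0
  bc4 : ∀ t ∈ Ioo (0:ℝ) T, pdx (pdx (pdx w)) L t = 0

theorem hF_sm {w : ℝ → ℝ → ℝ} (hw : Sm w) : Sm (hF w) :=
  ((hw.pdx.Td 1).pow 2).add (hw.pdx.mul (hw.pdx.Td 2))

theorem Mf_sm (D k : ℝ) {w : ℝ → ℝ → ℝ} (hw : Sm w) : Sm (Mf D k w) :=
  ((hw.pdx.pdx.cmul D).add ((hw.pdx.pdx.Td 1).cmul k)).add (((hw.pdx.pow 2).mul hw.pdx.pdx).cmul D)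

theorem Rf_sm (L D : ℝ) {w : ℝ → ℝ → ℝ} (hw : Sm w) : Sm (Rf L D w) :=
  (((hw.pdx.pdx.pow 2).mul hw.pdx).cmul D).add (hw.pdx.mul ((hF_sm hw).K L))

theorem pdt_hF {w : ℝ → ℝ → ℝ} (hw : Sm w) : pdt (hF w) = fun x t =>
    3 * Td 1 (pdx w) x t * Td 2 (pdx w) x t + pdx w x t * Td 3 (pdx w) x t := by
  funext x t
  have := ((Td_dt hw.pdx 1 x t).pow 2).add ((Td_dt hw.pdx 0 x t).mul (Td_dt hw.pdx 2 x t))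
  refine (this.congr_deriv ?_).deriv
  simp [-mul_eq_mul_left_iff, Td_zero]; ring

theorem pdt2_hF {w : ℝ → ℝ → ℝ} (hw : Sm w) : pdt (pdt (hF w)) = fun x t =>
    3 * (Td 2 (pdx w) x t) ^ 2 + 4 * Td 1 (pdx w) x t * Td 3 (pdx w) x t
      + pdx w x t * Td 4 (pdx w) x t := by
  rw [pdt_hF hw]
  funext x t
  have := (((Td_dt hw.pdx 1 x t).const_mul 3).mul (Td_dt hw.pdx 2 x t)).add
    ((Td_dt hw.pdx 0 x t).mul (Td_dt hw.pdx 3 x t))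
  refine (this.congr_deriv ?_).deriv
  simp [-mul_eq_mul_left_iff, Td_zero]; ring

theorem pdt_Mf (D k : ℝ) {w : ℝ → ℝ → ℝ} (hw : Sm w) : Td 1 (Mf D k w) = fun x t =>
    D * Td 1 (pdx (pdx w)) x t + k * Td 2 (pdx (pdx w)) x t
      + D * (2 * pdx w x t * Td 1 (pdx w) x t * pdx (pdx w) x t
        + (pdx w x t) ^ 2 * Td 1 (pdx (pdx w)) x t) := by
  funext x t
  have := (((Td_dt hw.pdx.pdx 0 x t).const_mul D).add ((Td_dt hw.pdx.pdx 1 x t).const_mul k)).add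
    ((((Td_dt hw.pdx 0 x t).pow 2).mul (Td_dt hw.pdx.pdx 0 x t)).const_mul D)
  refine (this.congr_deriv ?_).deriv
  simp [Td_zero]

theorem pdt2_Mf (D k : ℝ) {w : ℝ → ℝ → ℝ} (hw : Sm w) : Td 2 (Mf D k w) = fun x t =>
    D * Td 2 (pdx (pdx w)) x t + k * Td 3 (pdx (pdx w)) x t
      + D * (2 * (Td 1 (pdx w) x t) ^ 2 * pdx (pdx w) x t
        + 2 * pdx w x t * Td 2 (pdx w) x t * pdx (pdx w) x t
        + 4 * pdx w x t * Td 1 (pdx w) x t * Td 1 (pdx (pdx w)) x t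
        + (pdx w x t) ^ 2 * Td 2 (pdx (pdx w)) x t) := by
  rw [Td_succ, pdt_Mf D k hw]
  funext x t
  have := (((Td_dt hw.pdx.pdx 1 x t).const_mul D).add ((Td_dt hw.pdx.pdx 2 x t).const_mul k)).add
    ((((((Td_dt hw.pdx 0 x t).const_mul 2).mul (Td_dt hw.pdx 1 x t)).mul
      (Td_dt hw.pdx.pdx 0 x t)).add
      (((Td_dt hw.pdx 0 x t).pow 2).mul (Td_dt hw.pdx.pdx 1 x t))).const_mul D)
  refine (this.congr_deriv ?_).deriv
  simp [-mul_eq_mul_left_iff, Td_zero]; ring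

theorem pdt_Rf (L D : ℝ) {w : ℝ → ℝ → ℝ} (hw : Sm w) : Td 1 (Rf L D w) = fun x t =>
    D * (2 * pdx (pdx w) x t * Td 1 (pdx (pdx w)) x t * pdx w x t
        + (pdx (pdx w) x t) ^ 2 * Td 1 (pdx w) x t)
      + (Td 1 (pdx w) x t * Kp L (hF w) x t + pdx w x t * Kp L (pdt (hF w)) x t) := by
  funext x t
  have := ((((Td_dt hw.pdx.pdx 0 x t).pow 2).mul (Td_dt hw.pdx 0 x t)).const_mul D).add
    ((Td_dt hw.pdx 0 x t).mul (Kp_dt L (hF_sm hw) x t))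
  refine (this.congr_deriv ?_).deriv
  simp [Td_zero]

theorem pdt2_Rf (L D : ℝ) {w : ℝ → ℝ → ℝ} (hw : Sm w) : Td 2 (Rf L D w) = fun x t =>
    D * (2 * (Td 1 (pdx (pdx w)) x t) ^ 2 * pdx w x t
        + 2 * pdx (pdx w) x t * Td 2 (pdx (pdx w)) x t * pdx w x t
        + 4 * pdx (pdx w) x t * Td 1 (pdx (pdx w)) x t * Td 1 (pdx w) x t
        + (pdx (pdx w) x t) ^ 2 * Td 2 (pdx w) x t)
      + (Td 2 (pdx w) x t * Kp L (hF w) x t + 2 * Td 1 (pdx w) x t * Kp L (pdt (hF w)) x t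
        + pdx w x t * Kp L (pdt (pdt (hF w))) x t) := by
  rw [Td_succ, pdt_Rf L D hw]
  funext x t
  have := ((((((Td_dt hw.pdx.pdx 0 x t).const_mul 2).mul (Td_dt hw.pdx.pdx 1 x t)).mul
      (Td_dt hw.pdx 0 x t)).add
      (((Td_dt hw.pdx.pdx 0 x t).pow 2).mul (Td_dt hw.pdx 1 x t))).const_mul D).add
    (((Td_dt hw.pdx 1 x t).mul (Kp_dt L (hF_sm hw) x t)).add
      ((Td_dt hw.pdx 0 x t).mul (Kp_dt L (hF_sm hw).pdt x t)))
  refine (this.congr_deriv ?_).deriv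
  simp [-mul_eq_mul_left_iff, Td_zero]; ring

theorem Td_strong {a m r : ℝ → ℝ → ℝ} (ha : Sm a) (hm : Sm m) (hr : Sm r) (n : ℕ) :
    Td n (fun x t => a x t + pdx (pdx m) x t - pdx r x t)
      = fun x t => Td n a x t + pdx (pdx (Td n m)) x t - pdx (Td n r) x t := by
  rw [Td_pdx hm, Td_pdx hm.pdx, Td_pdx hr]
  induction n with
  | zero => rfl
  | succ n ih =>
    rw [Td_succ, ih]
    funext x t
    exact (((Td_dt ha n x t).add (Td_dt hm.pdx.pdx n x t)).sub (Td_dt hr.pdx n x t)).deriv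

theorem pdx_Mf (D k : ℝ) {w : ℝ → ℝ → ℝ} (hw : Sm w) : pdx (Mf D k w) = fun x t =>
    D * pdx (pdx (pdx w)) x t + k * Td 1 (pdx (pdx (pdx w))) x t
      + D * (2 * pdx w x t * pdx (pdx w) x t * pdx (pdx w) x t
        + (pdx w x t) ^ 2 * pdx (pdx (pdx w)) x t) := by
  funext x t
  have := (((hw.pdx.pdx.dx x t).const_mul D).add ((Td_dx hw.pdx.pdx 1 x t).const_mul k)).add
    ((((hw.pdx.dx x t).pow 2).mul (hw.pdx.pdx.dx x t)).const_mul D)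
  refine (this.congr_deriv ?_).deriv
  simp

theorem pdx2_Mf (D k : ℝ) {w : ℝ → ℝ → ℝ} (hw : Sm w) : pdx (pdx (Mf D k w)) = fun x t =>
    D * pdx (pdx (pdx (pdx w))) x t + k * Td 1 (pdx (pdx (pdx (pdx w)))) x t
      + D * (2 * (pdx (pdx w) x t) ^ 3 + 6 * pdx w x t * pdx (pdx w) x t * pdx (pdx (pdx w)) x t
        + (pdx w x t) ^ 2 * pdx (pdx (pdx (pdx w))) x t) := by
  rw [pdx_Mf D k hw]
  funext x t
  have := (((hw.pdx.pdx.pdx.dx x t).const_mul D).add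
      ((Td_dx hw.pdx.pdx.pdx 1 x t).const_mul k)).add
    ((((((hw.pdx.dx x t).const_mul 2).mul (hw.pdx.pdx.dx x t)).mul (hw.pdx.pdx.dx x t)).add
      (((hw.pdx.dx x t).pow 2).mul (hw.pdx.pdx.pdx.dx x t))).const_mul D)
  refine (this.congr_deriv ?_).deriv
  simp [-mul_eq_mul_left_iff]; ring

theorem pdx_Rf (L D : ℝ) {w : ℝ → ℝ → ℝ} (hw : Sm w) : pdx (Rf L D w) = fun x t =>
    D * (2 * pdx w x t * pdx (pdx w) x t * pdx (pdx (pdx w)) x t + (pdx (pdx w) x t) ^ 3)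
      + (pdx (pdx w) x t * Kp L (hF w) x t - pdx w x t * Jp (hF w) x t) := by
  funext x t
  have := ((((hw.pdx.pdx.dx x t).pow 2).mul (hw.pdx.dx x t)).const_mul D).add
    ((hw.pdx.dx x t).mul (Kp_dx L (hF_sm hw) x t))
  refine (this.congr_deriv ?_).deriv
  simp [-mul_eq_mul_left_iff]; ring

theorem Sol.weak {L D k T : ℝ} {w : ℝ → ℝ → ℝ} (hs : Sol L D k T w) (hL : 0 ≤ L) (n : ℕ)
    {φ : ℝ → ℝ → ℝ} (hφ : Sm φ) {t : ℝ} (ht : t ∈ Ioo (0:ℝ) T)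
    (h4 : φ 0 t = 0) (h5 : pdx φ 0 t = 0) :
    ∫ x in (0:ℝ)..L, (Td n (Td 2 w) x t * φ x t + Td n (Mf D k w) x t * pdx (pdx φ) x t
      + Td n (Rf L D w) x t * pdx φ x t) = 0 := by
  have hM := Mf_sm D k hs.sm
  have hR := Rf_sm L D hs.sm
  refine weak_form (hM.Td n) (hR.Td n) hφ t hL ?_ ?_ ?_ ?_ h4 h5
  · intro x hx
    have := Td_vanish (f := fun x t => Td 2 w x t + pdx (pdx (Mf D k w)) x t - pdx (Rf L D w) x t)
      (c := x) (fun t ht => hs.pde x hx t ht) n t ht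
    rwa [Td_strong (hs.sm.Td 2) hM hR] at this
  · refine Td_vanish (fun s hs' => ?_) n t ht
    simp only [Mf, hs.bc3 s hs', Td_vanish hs.bc3 1 s hs']; ring
  · rw [Td_pdx hM]
    refine Td_vanish (fun s hs' => ?_) n t ht
    simp only [pdx_Mf D k hs.sm, hs.bc3 s hs', hs.bc4 s hs', Td_vanish hs.bc4 1 s hs']; ring
  · refine Td_vanish (fun s hs' => ?_) n t ht
    simp only [Rf, hs.bc3 s hs', Kp_L]; ring

theorem abs_mul_le' {a b A B : ℝ} (ha : |a| ≤ A) (hb : |b| ≤ B) : |a * b| ≤ A * B := by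
  rw [abs_mul]
  exact mul_le_mul ha hb (abs_nonneg _) ((abs_nonneg _).trans ha)

theorem abs_mul_half {y z S : ℝ} (h : y ^ 2 + z ^ 2 ≤ 2 * S) : |y * z| ≤ S := by
  rw [abs_le]; constructor <;> nlinarith [sq_nonneg (y - z), sq_nonneg (y + z)]

/-- The constant in the pointwise bound for the nonlinear terms. -/
noncomputable def Cq (L D ε θ : ℝ) : ℝ :=
  D * (2 * L) + 2 * L ^ 4 + ε * (2 * (D * L) + 2 * L ^ 4) + (D * (6 * L) + 6 * L ^ 4)
    + (D * (18 * L) + 10 * L ^ 4) + θ * (D * (4 * L) + 3 * L ^ 3 + L ^ 2) + 6 * L ^ 4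

set_option maxHeartbeats 1000000 in
/-- Pointwise bound for all the nonlinear terms. -/
theorem quart {L D ε θ r α ν b p0 p1 p2 p3 q0 q1 q2 q3 w3 w4 K0 K1 J0 Z Y : ℝ}
    (hL : 0 < L) (hD : 0 < D) (hε : 0 < ε) (hθ : 0 < θ) (hr : 0 ≤ r) (hr2 : r ^ 2 = L)
    (hα : 0 ≤ α) (hαν : α ≤ ν) (hb : 0 ≤ b) (hbν : b ≤ ν)
    (h0 : |p0| ≤ r * α) (h1 : |p1| ≤ r * α) (h2 : |p2| ≤ r * α) (h3 : |p3| ≤ r * ν)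
    (hK0 : |K0| ≤ L ^ 2 * (2 * L * α ^ 2)) (hK1 : |K1| ≤ L ^ 2 * (4 * L * (α * ν)))
    (hJ0 : |J0| ≤ L * (2 * L * α ^ 2)) (hZ : |Z| ≤ L * (L * (α * ν)))
    (hY : |Y| ≤ L * (6 * L * (α * ν)))
    (hw3 : |w3| ≤ r * b) (hq0 : q0 ^ 2 ≤ 2 * (r * b) * (r * α)) :
    |(D * (p0 ^ 2 * q0) * q1 + D * (q0 ^ 2 * p0) * p1 + p0 * K0 * p1)
      + ε * (D * (p0 ^ 2 * q0) * q0 + D * (q0 ^ 2 * p0) * p0 + p0 * K0 * p0)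
      + (D * (2 * p0 * p1 * q0 + p0 ^ 2 * q1) * q2 + D * (2 * q0 * q1 * p0 + q0 ^ 2 * p1) * p2
        + (p1 * K0 + p0 * K1) * p2)
      + (D * (2 * p1 ^ 2 * q0 + 2 * p0 * p2 * q0 + 4 * p0 * p1 * q1 + p0 ^ 2 * q2) * q3
        + D * (2 * q1 ^ 2 * p0 + 2 * q0 * q2 * p0 + 4 * q0 * q1 * p1 + q0 ^ 2 * p2) * p3
        + (p2 * K0 + 2 * p1 * K1) * p3)
      + θ * ((D * (q0 ^ 3 + 4 * p0 * q0 * w3 + p0 ^ 2 * w4) - q0 * K0 + p0 * J0) * w4)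
      + Z * Y|
    ≤ Cq L D ε θ * (α ^ 2 * (q0 ^ 2 + q1 ^ 2 + q2 ^ 2 + q3 ^ 2 + w4 ^ 2)
      + ν ^ 2 * (q0 ^ 2 + q1 ^ 2 + q2 ^ 2) + α ^ 2 * ν ^ 2) := by
  set S := q0 ^ 2 + q1 ^ 2 + q2 ^ 2 + q3 ^ 2 + w4 ^ 2 with hS
  set S2 := q0 ^ 2 + q1 ^ 2 + q2 ^ 2 with hS2
  set T := α ^ 2 * S + ν ^ 2 * S2 + α ^ 2 * ν ^ 2 with hT
  have hν : 0 ≤ ν := hα.trans hαν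
  have hS0 : 0 ≤ S := by positivity
  have hS20 : 0 ≤ S2 := by positivity
  have t1 : α ^ 2 * S ≤ T := by have : 0 ≤ ν ^ 2 * S2 + α ^ 2 * ν ^ 2 := by positivity
                                linarith
  have t2 : ν ^ 2 * S2 ≤ T := by have : 0 ≤ α ^ 2 * S + α ^ 2 * ν ^ 2 := by positivity
                                 linarith
  have t3 : α ^ 2 * ν ^ 2 ≤ T := by have : 0 ≤ α ^ 2 * S + ν ^ 2 * S2 := by positivity
                                    linarith
  have hT0 : 0 ≤ T := by positivity
  have hαν' : α * ν ≤ ν ^ 2 := by nlinarith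
  have hα2 : α ^ 2 ≤ α * ν := by nlinarith
  have n1 := sq_nonneg q0
  have n2 := sq_nonneg q1
  have n3 := sq_nonneg q2
  have n4 := sq_nonneg q3
  have n5 := sq_nonneg w4
  have H1 : ∀ {p p' y z : ℝ}, |p| ≤ r * α → |p'| ≤ r * α → y ^ 2 + z ^ 2 ≤ 2 * S →
      |(p * p') * (y * z)| ≤ L * T := by
    intro p p' y z hp hp' hyz
    calc |(p * p') * (y * z)| ≤ ((r * α) * (r * α)) * S :=
          abs_mul_le' (abs_mul_le' hp hp') (abs_mul_half hyz)
      _ = L * (α ^ 2 * S) := by rw [← hr2]; ring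
      _ ≤ L * T := by gcongr
  have H2 : ∀ {p y z : ℝ}, |p| ≤ r * α → y ^ 2 + z ^ 2 ≤ 2 * S2 →
      |(p * p3) * (y * z)| ≤ L * T := by
    intro p y z hp hyz
    calc |(p * p3) * (y * z)| ≤ ((r * α) * (r * ν)) * S2 :=
          abs_mul_le' (abs_mul_le' hp h3) (abs_mul_half hyz)
      _ = L * ((α * ν) * S2) := by rw [← hr2]; ring
      _ ≤ L * (ν ^ 2 * S2) := by gcongr
      _ ≤ L * T := by gcongr
  have I1 : ∀ {p p' : ℝ}, |p| ≤ r * α → |p'| ≤ r * ν → |(p * p') * K0| ≤ 2 * L ^ 4 * T := by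
    intro p p' hp hp'
    calc |(p * p') * K0| ≤ ((r * α) * (r * ν)) * (L ^ 2 * (2 * L * α ^ 2)) :=
          abs_mul_le' (abs_mul_le' hp hp') hK0
      _ ≤ ((r * α) * (r * ν)) * (L ^ 2 * (2 * L * (α * ν))) := by gcongr
      _ = 2 * L ^ 4 * (α ^ 2 * ν ^ 2) := by
          rw [show (r * α) * (r * ν) = r ^ 2 * (α * ν) by ring, hr2]; ring
      _ ≤ 2 * L ^ 4 * T := by gcongr
  have I2 : ∀ {p p' : ℝ}, |p| ≤ r * α → |p'| ≤ r * ν → |(p * p') * K1| ≤ 4 * L ^ 4 * T := by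
    intro p p' hp hp'
    calc |(p * p') * K1| ≤ ((r * α) * (r * ν)) * (L ^ 2 * (4 * L * (α * ν))) :=
          abs_mul_le' (abs_mul_le' hp hp') hK1
      _ = 4 * L ^ 4 * (α ^ 2 * ν ^ 2) := by
          rw [show (r * α) * (r * ν) = r ^ 2 * (α * ν) by ring, hr2]; ring
      _ ≤ 4 * L ^ 4 * T := by gcongr
  have up : ∀ {p : ℝ}, |p| ≤ r * α → |p| ≤ r * ν := fun hp => hp.trans (by gcongr)
  -- level zero
  have B0 : |D * (p0 ^ 2 * q0) * q1 + D * (q0 ^ 2 * p0) * p1 + p0 * K0 * p1|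
      ≤ (D * (2 * L) + 2 * L ^ 4) * T := by
    have a1 := abs_le.1 (H1 h0 h0 (y := q0) (z := q1) (by linarith))
    have a2 := abs_le.1 (H1 h0 h1 (y := q0) (z := q0) (by linarith))
    have a3 := abs_le.1 (I1 h0 (up h1))
    have e : |(p0 * p0) * (q0 * q1) + (p0 * p1) * (q0 * q0)| ≤ 2 * L * T := by
      rw [abs_le]; constructor <;> linarith
    have e2 := abs_le.1 (abs_mul_le' (abs_of_pos hD).le e)
    rw [abs_le]; constructor <;> linarith
  have B0' : |D * (p0 ^ 2 * q0) * q0 + D * (q0 ^ 2 * p0) * p0 + p0 * K0 * p0|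
      ≤ (2 * (D * L) + 2 * L ^ 4) * T := by
    have a1 := H1 h0 h0 (y := q0) (z := q0) (by linarith)
    have a3 := abs_le.1 (I1 h0 (up h0))
    have e2 := abs_le.1 (abs_mul_le' (abs_of_pos hD).le a1)
    rw [abs_le]; constructor <;> linarith
  have B1 : |D * (2 * p0 * p1 * q0 + p0 ^ 2 * q1) * q2 + D * (2 * q0 * q1 * p0 + q0 ^ 2 * p1) * p2
        + (p1 * K0 + p0 * K1) * p2| ≤ (D * (6 * L) + 6 * L ^ 4) * T := by
    have a1 := abs_le.1 (H1 h0 h1 (y := q0) (z := q2) (by linarith))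
    have a2 := abs_le.1 (H1 h0 h0 (y := q1) (z := q2) (by linarith))
    have a3 := abs_le.1 (H1 h0 h2 (y := q0) (z := q1) (by linarith))
    have a4 := abs_le.1 (H1 h1 h2 (y := q0) (z := q0) (by linarith))
    have a5 := abs_le.1 (I1 h1 (up h2))
    have a6 := abs_le.1 (I2 h0 (up h2))
    have e : |2 * ((p0 * p1) * (q0 * q2)) + (p0 * p0) * (q1 * q2) + 2 * ((p0 * p2) * (q0 * q1))
        + (p1 * p2) * (q0 * q0)| ≤ 6 * L * T := by
      rw [abs_le]; constructor <;> linarith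
    have e2 := abs_le.1 (abs_mul_le' (abs_of_pos hD).le e)
    rw [abs_le]; constructor <;> linarith
  have B2 : |D * (2 * p1 ^ 2 * q0 + 2 * p0 * p2 * q0 + 4 * p0 * p1 * q1 + p0 ^ 2 * q2) * q3
        + D * (2 * q1 ^ 2 * p0 + 2 * q0 * q2 * p0 + 4 * q0 * q1 * p1 + q0 ^ 2 * p2) * p3
        + (p2 * K0 + 2 * p1 * K1) * p3| ≤ (D * (18 * L) + 10 * L ^ 4) * T := by
    have a1 := abs_le.1 (H1 h1 h1 (y := q0) (z := q3) (by linarith))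
    have a2 := abs_le.1 (H1 h0 h2 (y := q0) (z := q3) (by linarith))
    have a3 := abs_le.1 (H1 h0 h1 (y := q1) (z := q3) (by linarith))
    have a4 := abs_le.1 (H1 h0 h0 (y := q2) (z := q3) (by linarith))
    have b1 := abs_le.1 (H2 h0 (y := q1) (z := q1) (by linarith))
    have b2 := abs_le.1 (H2 h0 (y := q0) (z := q2) (by linarith))
    have b3 := abs_le.1 (H2 h1 (y := q0) (z := q1) (by linarith))
    have b4 := abs_le.1 (H2 h2 (y := q0) (z := q0) (by linarith))
    have a5 := abs_le.1 (I1 h2 h3)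
    have a6 := abs_le.1 (I2 h1 h3)
    have e : |2 * ((p1 * p1) * (q0 * q3)) + 2 * ((p0 * p2) * (q0 * q3))
        + 4 * ((p0 * p1) * (q1 * q3)) + (p0 * p0) * (q2 * q3)
        + 2 * ((p0 * p3) * (q1 * q1)) + 2 * ((p0 * p3) * (q0 * q2))
        + 4 * ((p1 * p3) * (q0 * q1)) + (p2 * p3) * (q0 * q0)| ≤ 18 * L * T := by
      rw [abs_le]; constructor <;> linarith
    have e2 := abs_le.1 (abs_mul_le' (abs_of_pos hD).le e)
    rw [abs_le]; constructor <;> linarith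
  have B3 : |(D * (q0 ^ 3 + 4 * p0 * q0 * w3 + p0 ^ 2 * w4) - q0 * K0 + p0 * J0) * w4|
      ≤ (D * (4 * L) + 3 * L ^ 3 + L ^ 2) * T := by
    have hx : (α * b) * |q0 * w4| ≤ T / 2 := by
      have : (α * b) * |q0 * w4| ≤ (b ^ 2 * q0 ^ 2 + α ^ 2 * w4 ^ 2) / 2 := by
        rw [abs_mul, ← sq_abs q0, ← sq_abs w4]
        nlinarith [sq_nonneg (b * |q0| - α * |w4|)]
      have b2 : b ^ 2 ≤ ν ^ 2 := by gcongr
      have : b ^ 2 * q0 ^ 2 ≤ ν ^ 2 * S2 := by gcongr; linarith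
      have : α ^ 2 * w4 ^ 2 ≤ α ^ 2 * S := by gcongr; linarith
      have : 0 ≤ α ^ 2 * ν ^ 2 := by positivity
      linarith
    have a1 : |q0 ^ 3 * w4| ≤ L * T := by
      calc |q0 ^ 3 * w4| = q0 ^ 2 * |q0 * w4| := by
            rw [show q0 ^ 3 * w4 = q0 ^ 2 * (q0 * w4) by ring, abs_mul,
              abs_of_nonneg (sq_nonneg q0)]
        _ ≤ (2 * (r * b) * (r * α)) * |q0 * w4| := by gcongr
        _ = 2 * r ^ 2 * ((α * b) * |q0 * w4|) := by ring
        _ ≤ 2 * r ^ 2 * (T / 2) := by gcongr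
        _ = L * T := by rw [hr2]; ring
    have a2 : |(p0 * w3) * (q0 * w4)| ≤ L * T / 2 := by
      calc |(p0 * w3) * (q0 * w4)| ≤ (r * α) * (r * b) * |q0 * w4| :=
            abs_mul_le' (abs_mul_le' h0 hw3) le_rfl
        _ = r ^ 2 * ((α * b) * |q0 * w4|) := by ring
        _ ≤ r ^ 2 * (T / 2) := by gcongr
        _ = L * T / 2 := by rw [hr2]; ring
    have a3 := abs_le.1 (H1 h0 h0 (y := w4) (z := w4) (by linarith))
    have a4 : |K0 * (q0 * w4)| ≤ 2 * L ^ 3 * T := by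
      calc |K0 * (q0 * w4)| ≤ (L ^ 2 * (2 * L * α ^ 2)) * S :=
            abs_mul_le' hK0 (abs_mul_half (by linarith))
        _ = 2 * L ^ 3 * (α ^ 2 * S) := by ring
        _ ≤ 2 * L ^ 3 * T := by gcongr
    have a5 : |J0 * (p0 * w4)| ≤ (L ^ 3 + L ^ 2) * T := by
      have hp0 : p0 ^ 2 ≤ L * α ^ 2 := by
        rw [← sq_abs, ← hr2, ← mul_pow]; gcongr
      calc |J0 * (p0 * w4)| ≤ (L * (2 * L * α ^ 2)) * ((L * α ^ 2 + w4 ^ 2) / 2) :=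
            abs_mul_le' hJ0 (abs_mul_half (by linarith))
        _ = L ^ 3 * (α ^ 2 * α ^ 2) + L ^ 2 * (α ^ 2 * w4 ^ 2) := by ring
        _ ≤ L ^ 3 * (α ^ 2 * ν ^ 2) + L ^ 2 * (α ^ 2 * S) := by
            have : w4 ^ 2 ≤ S := by linarith
            gcongr
        _ ≤ L ^ 3 * T + L ^ 2 * T := by gcongr
        _ = _ := by ring
    have a1' := abs_le.1 a1
    have a2' := abs_le.1 a2
    have a4' := abs_le.1 a4
    have a5' := abs_le.1 a5
    have e : |q0 ^ 3 * w4 + 4 * ((p0 * w3) * (q0 * w4)) + (p0 * p0) * (w4 * w4)| ≤ 4 * L * T := by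
      rw [abs_le]; constructor <;> linarith
    have e2 := abs_le.1 (abs_mul_le' (abs_of_pos hD).le e)
    rw [abs_le]; constructor <;> linarith
  have B4 : |Z * Y| ≤ 6 * L ^ 4 * T := by
    calc |Z * Y| ≤ (L * (L * (α * ν))) * (L * (6 * L * (α * ν))) := abs_mul_le' hZ hY
      _ = 6 * L ^ 4 * (α ^ 2 * ν ^ 2) := by ring
      _ ≤ 6 * L ^ 4 * T := by gcongr
  have C0 := abs_le.1 B0
  have C0' := abs_le.1 (abs_mul_le' (abs_of_pos hε).le B0')
  have C1 := abs_le.1 B1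
  have C2 := abs_le.1 B2
  have C3 := abs_le.1 (abs_mul_le' (abs_of_pos hθ).le B3)
  have C4 := abs_le.1 B4
  unfold Cq
  rw [abs_le]
  constructor <;> linarith

/-- `L²` norms of the time derivatives of the curvature. -/
noncomputable def aa (L : ℝ) (w : ℝ → ℝ → ℝ) (i : ℕ) (t : ℝ) : ℝ :=
  nn L (fun x => Td i (pdx (pdx w)) x t)

/-- `L²` norm of the fourth derivative. -/
noncomputable def bb (L : ℝ) (w : ℝ → ℝ → ℝ) (t : ℝ) : ℝ :=
  nn L (fun x => pdx (pdx (pdx (pdx w))) x t)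

noncomputable def AA (L : ℝ) (w : ℝ → ℝ → ℝ) (t : ℝ) : ℝ :=
  aa L w 0 t ^ 2 + aa L w 1 t ^ 2 + aa L w 2 t ^ 2

noncomputable def NN (L : ℝ) (w : ℝ → ℝ → ℝ) (t : ℝ) : ℝ :=
  AA L w t + aa L w 3 t ^ 2 + bb L w t ^ 2

/-- Highest-order part of `u_ttt`. -/
noncomputable def Zf (w : ℝ → ℝ → ℝ) : ℝ → ℝ → ℝ :=
  Jp (fun x t => pdx w x t * Td 3 (pdx w) x t)

theorem Zf_sm {w : ℝ → ℝ → ℝ} (hw : Sm w) : Sm (Zf w) := (hw.pdx.mul (hw.pdx.Td 3)).J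

/-- Energy density. -/
noncomputable def ed (D k ε θ : ℝ) (w : ℝ → ℝ → ℝ) : ℝ → ℝ → ℝ := fun x t =>
  1 / 2 * (Td 1 w x t) ^ 2 + D / 2 * (Td 0 (pdx (pdx w)) x t) ^ 2 + ε * (Td 0 w x t * Td 1 w x t)
    + ε * k / 2 * (Td 0 (pdx (pdx w)) x t) ^ 2
    + 1 / 2 * (Td 2 w x t) ^ 2 + D / 2 * (Td 1 (pdx (pdx w)) x t) ^ 2
    + 1 / 2 * (Td 3 w x t) ^ 2 + D / 2 * (Td 2 (pdx (pdx w)) x t) ^ 2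
    + 1 / 2 * (Zf w x t) ^ 2 + θ * k / 2 * (Td 0 (pdx (pdx (pdx (pdx w)))) x t) ^ 2

theorem ed_sm (D k ε θ : ℝ) {w : ℝ → ℝ → ℝ} (hw : Sm w) : Sm (ed D k ε θ w) := by
  have h2 := hw.pdx.pdx
  have h4 := h2.pdx.pdx
  exact ((((((((((((hw.Td 1).pow 2).cmul _).add (((h2.Td 0).pow 2).cmul _)).add
    (((hw.Td 0).mul (hw.Td 1)).cmul _)).add
    (((h2.Td 0).pow 2).cmul _)).add (((hw.Td 2).pow 2).cmul _)).add
    (((h2.Td 1).pow 2).cmul _)).add (((hw.Td 3).pow 2).cmul _)).add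
    (((h2.Td 2).pow 2).cmul _)).add (((Zf_sm hw).pow 2).cmul _)).add (((h4.Td 0).pow 2).cmul _))

theorem pdt_Zf {w : ℝ → ℝ → ℝ} (hw : Sm w) : pdt (Zf w) =
    Jp (fun x t => Td 1 (pdx w) x t * Td 3 (pdx w) x t + pdx w x t * Td 4 (pdx w) x t) := by
  unfold Zf
  rw [(hw.pdx.mul (hw.pdx.Td 3)).pdt_J]
  congr 1
  funext x t
  exact ((Td_dt hw.pdx 0 x t).mul (Td_dt hw.pdx 3 x t)).deriv

theorem pdt_ed (D k ε θ : ℝ) {w : ℝ → ℝ → ℝ} (hw : Sm w) (x t : ℝ) : pdt (ed D k ε θ w) x t =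
    Td 1 w x t * Td 2 w x t + D * (pdx (pdx w) x t * Td 1 (pdx (pdx w)) x t)
    + ε * (Td 1 w x t ^ 2 + w x t * Td 2 w x t)
    + ε * k * (pdx (pdx w) x t * Td 1 (pdx (pdx w)) x t)
    + Td 2 w x t * Td 3 w x t + D * (Td 1 (pdx (pdx w)) x t * Td 2 (pdx (pdx w)) x t)
    + Td 3 w x t * Td 4 w x t + D * (Td 2 (pdx (pdx w)) x t * Td 3 (pdx (pdx w)) x t)
    + Zf w x t * pdt (Zf w) x t
    + θ * k * (pdx (pdx (pdx (pdx w))) x t * Td 1 (pdx (pdx (pdx (pdx w)))) x t) := by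
  have h2 := hw.pdx.pdx
  have h4 := h2.pdx.pdx
  have := (((((((((((Td_dt hw 1 x t).pow 2).const_mul (1 / 2)).add
    (((Td_dt h2 0 x t).pow 2).const_mul (D / 2))).add
    (((Td_dt hw 0 x t).mul (Td_dt hw 1 x t)).const_mul ε)).add
    (((Td_dt h2 0 x t).pow 2).const_mul (ε * k / 2))).add
    (((Td_dt hw 2 x t).pow 2).const_mul (1 / 2))).add
    (((Td_dt h2 1 x t).pow 2).const_mul (D / 2))).add
    (((Td_dt hw 3 x t).pow 2).const_mul (1 / 2))).add
    (((Td_dt h2 2 x t).pow 2).const_mul (D / 2))).add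
    ((((Zf_sm hw).dt x t).pow 2).const_mul (1 / 2))).add
    (((Td_dt h4 0 x t).pow 2).const_mul (θ * k / 2))
  refine (this.congr_deriv ?_).deriv
  simp [-mul_eq_mul_left_iff, Td_zero]; ring

/-- Vanishing extends to the closed end. -/
theorem van_closed {f : ℝ → ℝ → ℝ} (hf : Sm f) {c T : ℝ} (h : ∀ t ∈ Ioo (0:ℝ) T, f c t = 0)
    {t : ℝ} (ht : t ∈ Ico (0:ℝ) T) : f c t = 0 := by
  have hc : Continuous (fun s => f c s) := hf.contt c
  have hcl : IsClosed {s | f c s = 0} := isClosed_eq hc continuous_const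
  have : closure (Ioo (0:ℝ) T) ⊆ {s | f c s = 0} := hcl.closure_subset_iff.2 h
  apply this
  rw [closure_Ioo (ne_of_lt (ht.1.trans_lt ht.2))]
  exact ⟨ht.1, ht.2.le⟩

theorem Sol.p_sup {L D k T : ℝ} {w : ℝ → ℝ → ℝ} (hs : Sol L D k T w) (hL : 0 < L) (i : ℕ)
    {x t : ℝ} (hx : x ∈ Icc (0:ℝ) L) (ht : t ∈ Ico (0:ℝ) T) :
    |Td i (pdx w) x t| ≤ √L * aa L w i t :=
  sup_le_nn (p := fun x => Td i (pdx w) x t) hL ((hs.sm.pdx.pdx.Td i).contx t)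
    (fun y => Td_dx hs.sm.pdx i y t)
    (c := 0) ⟨le_rfl, hL.le⟩ (van_closed (hs.sm.pdx.Td i) (Td_vanish hs.bc2 i) ht) hx

theorem Sol.v_sup {L D k T : ℝ} {w : ℝ → ℝ → ℝ} (hs : Sol L D k T w) (hL : 0 < L) (i : ℕ)
    {x t : ℝ} (hx : x ∈ Icc (0:ℝ) L) (ht : t ∈ Ico (0:ℝ) T) :
    Td i w x t ^ 2 ≤ L ^ 3 * aa L w i t ^ 2 := by
  have h := sup_le_int (p := fun x => Td i w x t) ((hs.sm.pdx.Td i).contx t)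
    (fun y => Td_dx hs.sm i y t)
    (c := 0) ⟨le_rfl, hL.le⟩ (van_closed (hs.sm.Td i) (Td_vanish hs.bc1 i) ht) hx
  have h2 := int_le_const hL.le ((hs.sm.pdx.Td i).contx t).abs
    (fun y hy => hs.p_sup hL i hy ht)
  have h3 := h.trans h2
  have h4 : √L ^ 2 = L := Real.sq_sqrt hL.le
  calc Td i w x t ^ 2 = |Td i w x t| ^ 2 := (sq_abs _).symm
    _ ≤ (L * (√L * aa L w i t)) ^ 2 := by gcongr
    _ = L ^ 2 * √L ^ 2 * aa L w i t ^ 2 := by ring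
    _ = _ := by rw [h4]; ring

theorem Sol.w3_sup {L D k T : ℝ} {w : ℝ → ℝ → ℝ} (hs : Sol L D k T w) (hL : 0 < L)
    {x t : ℝ} (hx : x ∈ Icc (0:ℝ) L) (ht : t ∈ Ico (0:ℝ) T) :
    |pdx (pdx (pdx w)) x t| ≤ √L * bb L w t :=
  sup_le_nn (p := fun x => pdx (pdx (pdx w)) x t) hL (hs.sm.pdx.pdx.pdx.pdx.contx t)
    (fun y => hs.sm.pdx.pdx.pdx.dx y t)
    (c := L) ⟨hL.le, le_rfl⟩ (van_closed hs.sm.pdx.pdx.pdx hs.bc4 ht) hx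

theorem Sol.q0_sup {L D k T : ℝ} {w : ℝ → ℝ → ℝ} (hs : Sol L D k T w) (hL : 0 < L)
    {x t : ℝ} (hx : x ∈ Icc (0:ℝ) L) (ht : t ∈ Ico (0:ℝ) T) :
    pdx (pdx w) x t ^ 2 ≤ 2 * (√L * bb L w t) * (√L * aa L w 0 t) := by
  have h2 := hs.sm.pdx.pdx
  have h := sup_le_int (p := fun x => pdx (pdx w) x t ^ 2)
    (q := fun x => 2 * (pdx (pdx w) x t * pdx (pdx (pdx w)) x t))
    ((((h2.contx t).mul (h2.pdx.contx t)).const_mul 2))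
    (fun y => by
      have := (h2.dx y t).pow 2
      refine this.congr_deriv ?_
      simp; ring)
    (c := L) ⟨hL.le, le_rfl⟩ (by simp [van_closed h2 hs.bc3 ht]) hx
  have h3 : ∫ x in (0:ℝ)..L, |2 * (pdx (pdx w) x t * pdx (pdx (pdx w)) x t)|
      ≤ ∫ x in (0:ℝ)..L, 2 * (√L * bb L w t) * |pdx (pdx w) x t| := by
    apply intervalIntegral.integral_mono_on hL.le
    · exact ((((h2.contx t).mul (h2.pdx.contx t)).const_mul 2).abs).intervalIntegrable _ _
    · exact (((h2.contx t).abs).const_mul _).intervalIntegrable _ _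
    · intro y hy
      have := hs.w3_sup hL hy ht
      rw [abs_mul, abs_mul, abs_two]
      nlinarith [abs_nonneg (pdx (pdx w) y t)]
  rw [intervalIntegral.integral_const_mul] at h3
  have h5 : 0 ≤ √L * bb L w t := mul_nonneg (Real.sqrt_nonneg _) (nn_nonneg _ _)
  have h6 := int_abs_le hL (h2.contx t)
  calc pdx (pdx w) x t ^ 2 = |pdx (pdx w) x t ^ 2| := (abs_of_nonneg (sq_nonneg _)).symm
    _ ≤ _ := h
    _ ≤ _ := h3
    _ ≤ _ := by gcongr; exact h6

theorem int_lin {L : ℝ} {f0 f1 f2 f3 f4 : ℝ → ℝ} (h0 : Continuous f0) (h1 : Continuous f1)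
    (h2 : Continuous f2) (h3 : Continuous f3) (h4 : Continuous f4) (c c0 c1 c2 c3 c4 : ℝ) :
    ∫ x in (0:ℝ)..L, (c + c0 * f0 x + c1 * f1 x + c2 * f2 x + c3 * f3 x + c4 * f4 x)
      = L * c + c0 * (∫ x in (0:ℝ)..L, f0 x) + c1 * (∫ x in (0:ℝ)..L, f1 x)
        + c2 * (∫ x in (0:ℝ)..L, f2 x)
        + c3 * (∫ x in (0:ℝ)..L, f3 x) + c4 * (∫ x in (0:ℝ)..L, f4 x) := by
  have I : ∀ {f : ℝ → ℝ}, Continuous f → IntervalIntegrable f volume 0 L :=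
    fun h => h.intervalIntegrable _ _
  rw [intervalIntegral.integral_add (I (by fun_prop)) (I (by fun_prop)),
    intervalIntegral.integral_add (I (by fun_prop)) (I (by fun_prop)),
    intervalIntegral.integral_add (I (by fun_prop)) (I (by fun_prop)),
    intervalIntegral.integral_add (I (by fun_prop)) (I (by fun_prop)),
    intervalIntegral.integral_add (I (by fun_prop)) (I (by fun_prop))]
  simp

theorem aa_sq {L : ℝ} (hL : 0 < L) (w : ℝ → ℝ → ℝ) (i : ℕ) (t : ℝ) :
    aa L w i t ^ 2 = ∫ x in (0:ℝ)..L, (Td i (pdx (pdx w)) x t) ^ 2 := nn_sq hL _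

theorem bb_sq {L : ℝ} (hL : 0 < L) (w : ℝ → ℝ → ℝ) (t : ℝ) :
    bb L w t ^ 2 = ∫ x in (0:ℝ)..L, (pdx (pdx (pdx (pdx w))) x t) ^ 2 := nn_sq hL _

theorem int_add_zero {L : ℝ} {f g : ℝ → ℝ} (hf : Continuous f) (hg : Continuous g)
    (h : ∫ x in (0:ℝ)..L, g x = 0) :
    ∫ x in (0:ℝ)..L, f x = ∫ x in (0:ℝ)..L, (f x - g x) := by
  rw [intervalIntegral.integral_sub (hf.intervalIntegrable _ _) (hg.intervalIntegrable _ _), h,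
    sub_zero]

theorem Jp_add {f g h : ℝ → ℝ → ℝ} (hf : Sm f) (hg : Sm g) (e : ∀ x t, h x t = f x t + g x t)
    (x t : ℝ) : Jp h x t = Jp f x t + Jp g x t := by
  unfold Jp
  rw [← intervalIntegral.integral_add ((hf.contx t).intervalIntegrable _ _)
    ((hg.contx t).intervalIntegrable _ _)]
  simp only [e]

noncomputable def Yd (w : ℝ → ℝ → ℝ) : ℝ → ℝ → ℝ := fun x t =>
  3 * Td 2 (pdx w) x t ^ 2 + 3 * (Td 1 (pdx w) x t * Td 3 (pdx w) x t)

theorem Yd_sm {w : ℝ → ℝ → ℝ} (hw : Sm w) : Sm (Yd w) :=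
  (((hw.pdx.Td 2).pow 2).cmul 3).add (((hw.pdx.Td 1).mul (hw.pdx.Td 3)).cmul 3)

/-- The nonlinear density. -/
noncomputable def Qd (L D ε θ : ℝ) (w : ℝ → ℝ → ℝ) (x t : ℝ) : ℝ :=
  let p0 := pdx w x t
  let p1 := Td 1 (pdx w) x t
  let p2 := Td 2 (pdx w) x t
  let p3 := Td 3 (pdx w) x t
  let q0 := pdx (pdx w) x t
  let q1 := Td 1 (pdx (pdx w)) x t
  let q2 := Td 2 (pdx (pdx w)) x t
  let q3 := Td 3 (pdx (pdx w)) x t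
  let w3 := pdx (pdx (pdx w)) x t
  let w4 := pdx (pdx (pdx (pdx w))) x t
  let K0 := Kp L (hF w) x t
  let K1 := Kp L (pdt (hF w)) x t
  let J0 := Jp (hF w) x t
  let Z := Zf w x t
  let Y := Jp (Yd w) x t
  (D * (p0 ^ 2 * q0) * q1 + D * (q0 ^ 2 * p0) * p1 + p0 * K0 * p1)
      + ε * (D * (p0 ^ 2 * q0) * q0 + D * (q0 ^ 2 * p0) * p0 + p0 * K0 * p0)
      + (D * (2 * p0 * p1 * q0 + p0 ^ 2 * q1) * q2 + D * (2 * q0 * q1 * p0 + q0 ^ 2 * p1) * p2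
        + (p1 * K0 + p0 * K1) * p2)
      + (D * (2 * p1 ^ 2 * q0 + 2 * p0 * p2 * q0 + 4 * p0 * p1 * q1 + p0 ^ 2 * q2) * q3
        + D * (2 * q1 ^ 2 * p0 + 2 * q0 * q2 * p0 + 4 * q0 * q1 * p1 + q0 ^ 2 * p2) * p3
        + (p2 * K0 + 2 * p1 * K1) * p3)
      + θ * ((D * (q0 ^ 3 + 4 * p0 * q0 * w3 + p0 ^ 2 * w4) - q0 * K0 + p0 * J0) * w4)
      + Z * Y

/-- The dissipation density. -/
noncomputable def dens (L D k ε θ : ℝ) (w : ℝ → ℝ → ℝ) (x t : ℝ) : ℝ :=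
  ε * Td 1 w x t ^ 2 - k * (Td 1 (pdx (pdx w)) x t ^ 2 + Td 2 (pdx (pdx w)) x t ^ 2
    + Td 3 (pdx (pdx w)) x t ^ 2) - ε * D * pdx (pdx w) x t ^ 2
    - θ * (Td 2 w x t * pdx (pdx (pdx (pdx w))) x t)
    - θ * D * pdx (pdx (pdx (pdx w))) x t ^ 2 - Qd L D ε θ w x t

theorem Sol.diss {L D k T : ℝ} {w : ℝ → ℝ → ℝ} (hs : Sol L D k T w) (hL : 0 < L) (ε θ : ℝ)
    {t : ℝ} (ht : t ∈ Ioo (0:ℝ) T) :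
    ∃ f : ℝ → ℝ, Continuous f ∧ (∀ x ∈ Icc (0:ℝ) L, f x = dens L D k ε θ w x t) ∧
      ∫ x in (0:ℝ)..L, pdt (ed D k ε θ w) x t = ∫ x in (0:ℝ)..L, f x := by
  have hw := hs.sm
  have hM := Mf_sm D k hw
  have hR := Rf_sm L D hw
  have hG : ∀ (n : ℕ) {φ : ℝ → ℝ → ℝ}, Sm φ → Sm (fun x t => Td n (Td 2 w) x t * φ x t
      + Td n (Mf D k w) x t * pdx (pdx φ) x t + Td n (Rf L D w) x t * pdx φ x t) := fun n φ hφ =>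
    ((((hw.Td 2).Td n).mul hφ).add ((hM.Td n).mul hφ.pdx.pdx)).add ((hR.Td n).mul hφ.pdx)
  have hW : ∀ n i : ℕ, ∫ x in (0:ℝ)..L, (Td n (Td 2 w) x t * Td i w x t
      + Td n (Mf D k w) x t * pdx (pdx (Td i w)) x t + Td n (Rf L D w) x t * pdx (Td i w) x t)
      = 0 := fun n i => hs.weak hL.le n (hw.Td i) ht (Td_vanish hs.bc1 i t ht) (by
        rw [Td_pdx hw]; exact Td_vanish hs.bc2 i t ht)
  have hh2 := (hF_sm hw).pdt.pdt
  have hpp := hw.pdx.mul (hw.pdx.Td 3)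
  have hKc : ∫ x in (0:ℝ)..L, (Zf w x t * Jp (pdt (pdt (hF w))) x t
      - pdx w x t * Td 3 (pdx w) x t * Kp L (pdt (pdt (hF w))) x t) = 0 := by
    rw [intervalIntegral.integral_sub
      (((Zf_sm hw).mul hh2.J).contx t |>.intervalIntegrable _ _)
      ((hpp.mul (hh2.K L)).contx t |>.intervalIntegrable _ _), sub_eq_zero]
    exact (int_Kp hpp hh2 t).symm
  have c0 := (ed_sm D k ε θ hw).pdt.contx t
  have c1 := (hG 0 (hw.Td 1)).contx t
  have c2 := ((hG 0 (hw.Td 0)).contx t).const_mul ε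
  have c3 := (hG 1 (hw.Td 2)).contx t
  have c4 := (hG 2 (hw.Td 3)).contx t
  have c5 := (((Zf_sm hw).mul hh2.J).sub (hpp.mul (hh2.K L))).contx t
  have c6 := ((((hw.Td 2).add hM.pdx.pdx).sub hR.pdx).mul (hw.pdx.pdx.pdx.pdx.cmul θ)).contx t
  have c7 : ∫ x in (0:ℝ)..L, (Td 2 w x t + pdx (pdx (Mf D k w)) x t - pdx (Rf L D w) x t)
      * (θ * pdx (pdx (pdx (pdx w))) x t) = 0 := by
    refine Eq.trans ?_ (intervalIntegral.integral_zero (a := 0) (b := L) (E := ℝ) (μ := volume))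
    apply intervalIntegral.integral_congr
    intro x hx
    rw [uIcc_of_le hL.le] at hx
    simp only [hs.pde x hx t ht, zero_mul]
  refine ⟨_, (((((c0.sub c1).sub c2).sub c3).sub c4).sub c5).sub c6, ?_, ?_⟩
  · intro x hx
    simp only [Pi.sub_apply]
    have hJ : Jp (pdt (pdt (hF w))) x t = pdt (Zf w) x t + Jp (Yd w) x t := by
      rw [pdt_Zf hw]
      refine Jp_add (((hw.pdx.Td 1).mul (hw.pdx.Td 3)).add (hw.pdx.mul (hw.pdx.Td 4)))
        (Yd_sm hw) (fun x t => ?_) x t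
      rw [pdt2_hF hw]; simp only [Yd]; ring
    have e1 : ∀ i, pdx (Td i w) = Td i (pdx w) := Td_pdx hw
    have e2 : ∀ i, pdx (Td i (pdx w)) = Td i (pdx (pdx w)) := Td_pdx hw.pdx
    have r3 : Td 1 (Td 2 w) x t = Td 3 w x t := rfl
    have r4 : Td 2 (Td 2 w) x t = Td 4 w x t := rfl
    simp only [e1, e2, hJ, r3, r4, pdt_ed D k ε θ hw, pdt_Mf D k hw, pdt2_Mf D k hw,
      pdt_Rf L D hw, pdt2_Rf L D hw, pdx2_Mf D k hw, pdx_Rf L D hw, dens, Qd, Td_zero, Mf, Rf]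
    ring
  · have hW00 : ∫ x in (0:ℝ)..L, ε * (Td 0 (Td 2 w) x t * Td 0 w x t
      + Td 0 (Mf D k w) x t * pdx (pdx (Td 0 w)) x t + Td 0 (Rf L D w) x t * pdx (Td 0 w) x t)
      = 0 := by
      rw [intervalIntegral.integral_const_mul]
      exact mul_eq_zero_of_right _ (hW 0 0)
    exact (int_add_zero c0 c1 (hW 0 1)).trans ((int_add_zero (c0.sub c1) c2 hW00).trans
      ((int_add_zero ((c0.sub c1).sub c2) c3 (hW 1 2)).trans
      ((int_add_zero (((c0.sub c1).sub c2).sub c3) c4 (hW 2 3)).trans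
      ((int_add_zero ((((c0.sub c1).sub c2).sub c3).sub c4) c5 hKc).trans
      (int_add_zero (((((c0.sub c1).sub c2).sub c3).sub c4).sub c5) c6 c7)))))

noncomputable def eps (L k : ℝ) : ℝ := k / (2 * L ^ 4)
noncomputable def tht (L D k : ℝ) : ℝ := k * D / L ^ 4

noncomputable def FF (L D k : ℝ) (w : ℝ → ℝ → ℝ) (t : ℝ) : ℝ :=
  ∫ x in (0:ℝ)..L, ed D k (eps L k) (tht L D k) w x t

theorem aa_nonneg (L : ℝ) (w : ℝ → ℝ → ℝ) (i : ℕ) (t : ℝ) : 0 ≤ aa L w i t := nn_nonneg _ _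
theorem bb_nonneg (L : ℝ) (w : ℝ → ℝ → ℝ) (t : ℝ) : 0 ≤ bb L w t := nn_nonneg _ _

theorem AA_nonneg (L : ℝ) (w : ℝ → ℝ → ℝ) (t : ℝ) : 0 ≤ AA L w t := by unfold AA; positivity
theorem NN_nonneg (L : ℝ) (w : ℝ → ℝ → ℝ) (t : ℝ) : 0 ≤ NN L w t := by
  have := AA_nonneg L w t
  unfold NN; positivity

theorem aa_le_A (L : ℝ) (w : ℝ → ℝ → ℝ) (i : ℕ) (hi : i ≤ 2) (t : ℝ) : aa L w i t ≤ √(AA L w t) := by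
  apply Real.le_sqrt_of_sq_le
  have h0 := sq_nonneg (aa L w 0 t)
  have h1 := sq_nonneg (aa L w 1 t)
  have h2 := sq_nonneg (aa L w 2 t)
  unfold AA
  interval_cases i <;> linarith

theorem A_le_N (L : ℝ) (w : ℝ → ℝ → ℝ) (t : ℝ) : √(AA L w t) ≤ √(NN L w t) := by
  apply Real.sqrt_le_sqrt
  have h0 := sq_nonneg (aa L w 3 t)
  have h1 := sq_nonneg (bb L w t)
  unfold NN; linarith

theorem aa3_le_N (L : ℝ) (w : ℝ → ℝ → ℝ) (t : ℝ) : aa L w 3 t ≤ √(NN L w t) := by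
  apply Real.le_sqrt_of_sq_le
  have h0 := AA_nonneg L w t
  have h1 := sq_nonneg (bb L w t)
  unfold NN; linarith

theorem bb_le_N (L : ℝ) (w : ℝ → ℝ → ℝ) (t : ℝ) : bb L w t ≤ √(NN L w t) := by
  apply Real.le_sqrt_of_sq_le
  have h0 := AA_nonneg L w t
  have h1 := sq_nonneg (aa L w 3 t)
  unfold NN; linarith

theorem Sol.p_le {L D k T : ℝ} {w : ℝ → ℝ → ℝ} (hs : Sol L D k T w) (hL : 0 < L) {i : ℕ}
    (hi : i ≤ 2) {x t : ℝ} (hx : x ∈ Icc (0:ℝ) L) (ht : t ∈ Ico (0:ℝ) T) :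
    |Td i (pdx w) x t| ≤ √L * √(AA L w t) :=
  (hs.p_sup hL i hx ht).trans (mul_le_mul_of_nonneg_left (aa_le_A L w i hi t) (Real.sqrt_nonneg _))

theorem Sol.p3_le {L D k T : ℝ} {w : ℝ → ℝ → ℝ} (hs : Sol L D k T w) (hL : 0 < L)
    {x t : ℝ} (hx : x ∈ Icc (0:ℝ) L) (ht : t ∈ Ico (0:ℝ) T) :
    |Td 3 (pdx w) x t| ≤ √L * √(NN L w t) :=
  (hs.p_sup hL 3 hx ht).trans (mul_le_mul_of_nonneg_left (aa3_le_N L w t) (Real.sqrt_nonneg _))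

theorem Sol.Z_le {L D k T : ℝ} {w : ℝ → ℝ → ℝ} (hs : Sol L D k T w) (hL : 0 < L)
    {x t : ℝ} (hx : x ∈ Icc (0:ℝ) L) (ht : t ∈ Ico (0:ℝ) T) :
    |Zf w x t| ≤ L * (L * (√(AA L w t) * √(NN L w t))) := by
  refine Jp_bound (fun y hy => ?_) hx
  have h4 : √L ^ 2 = L := Real.sq_sqrt hL.le
  calc |pdx w y t * Td 3 (pdx w) y t| ≤ (√L * √(AA L w t)) * (√L * √(NN L w t)) :=
        abs_mul_le' (hs.p_le hL (i := 0) (by norm_num) hy ht) (hs.p3_le hL hy ht)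
    _ = √L ^ 2 * (√(AA L w t) * √(NN L w t)) := by ring
    _ = _ := by rw [h4]

theorem Sol.Q_le {L D k T : ℝ} {w : ℝ → ℝ → ℝ} (hs : Sol L D k T w) (hL : 0 < L) (hD : 0 < D)
    {ε θ : ℝ} (hε : 0 < ε) (hθ : 0 < θ)
    {x t : ℝ} (hx : x ∈ Icc (0:ℝ) L) (ht : t ∈ Ico (0:ℝ) T) :
    |Qd L D ε θ w x t| ≤ Cq L D ε θ * (AA L w t * ((pdx (pdx w) x t) ^ 2
      + (Td 1 (pdx (pdx w)) x t) ^ 2 + (Td 2 (pdx (pdx w)) x t) ^ 2 + (Td 3 (pdx (pdx w)) x t) ^ 2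
      + (pdx (pdx (pdx (pdx w))) x t) ^ 2)
      + NN L w t * ((pdx (pdx w) x t) ^ 2
      + (Td 1 (pdx (pdx w)) x t) ^ 2 + (Td 2 (pdx (pdx w)) x t) ^ 2) + AA L w t * NN L w t) := by
  have h4 : √L ^ 2 = L := Real.sq_sqrt hL.le
  have hA2 : √(AA L w t) ^ 2 = AA L w t := Real.sq_sqrt (AA_nonneg L w t)
  have hN2 : √(NN L w t) ^ 2 = NN L w t := Real.sq_sqrt (NN_nonneg L w t)
  have hAN := A_le_N L w t
  have hαα : √(AA L w t) * √(AA L w t) ≤ √(AA L w t) * √(NN L w t) := by gcongr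
  have prod : ∀ {i j : ℕ}, i ≤ 2 → j ≤ 2 → ∀ y ∈ Icc (0:ℝ) L,
      |Td i (pdx w) y t * Td j (pdx w) y t| ≤ L * (√(AA L w t)) ^ 2 := by
    intro i j hi hj y hy
    calc _ ≤ (√L * √(AA L w t)) * (√L * √(AA L w t)) :=
          abs_mul_le' (hs.p_le hL hi hy ht) (hs.p_le hL hj hy ht)
      _ = √L ^ 2 * (√(AA L w t)) ^ 2 := by ring
      _ = _ := by rw [h4]
  have prod2 : ∀ {i j : ℕ}, i ≤ 2 → j ≤ 2 → ∀ y ∈ Icc (0:ℝ) L,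
      |Td i (pdx w) y t * Td j (pdx w) y t| ≤ L * (√(AA L w t) * √(NN L w t)) := by
    intro i j hi hj y hy
    refine (prod hi hj y hy).trans ?_
    rw [sq]; gcongr
  have prod3 : ∀ {i : ℕ}, i ≤ 2 → ∀ y ∈ Icc (0:ℝ) L,
      |Td i (pdx w) y t * Td 3 (pdx w) y t| ≤ L * (√(AA L w t) * √(NN L w t)) := by
    intro i hi y hy
    calc _ ≤ (√L * √(AA L w t)) * (√L * √(NN L w t)) :=
          abs_mul_le' (hs.p_le hL hi hy ht) (hs.p3_le hL hy ht)
      _ = √L ^ 2 * (√(AA L w t) * √(NN L w t)) := by ring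
      _ = _ := by rw [h4]
  have hh : ∀ y ∈ Icc (0:ℝ) L, |hF w y t| ≤ 2 * L * √(AA L w t) ^ 2 := by
    intro y hy
    have a1 := abs_le.1 (prod (i := 1) (j := 1) (by norm_num) (by norm_num) y hy)
    have a2 := abs_le.1 (prod (i := 0) (j := 2) (by norm_num) (by norm_num) y hy)
    rw [Td_zero] at a2
    unfold hF
    rw [abs_le]; constructor <;> linarith
  have hh1 : ∀ y ∈ Icc (0:ℝ) L, |pdt (hF w) y t| ≤ 4 * L * (√(AA L w t) * √(NN L w t)) := by
    intro y hy
    have a1 := abs_le.1 (prod2 (i := 1) (j := 2) (by norm_num) (by norm_num) y hy)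
    have a2 := abs_le.1 (prod3 (i := 0) (by norm_num) y hy)
    rw [Td_zero] at a2
    rw [pdt_hF hs.sm]
    rw [abs_le]; constructor <;> linarith
  have hY : ∀ y ∈ Icc (0:ℝ) L, |Yd w y t| ≤ 6 * L * (√(AA L w t) * √(NN L w t)) := by
    intro y hy
    have a1 := abs_le.1 (prod2 (i := 2) (j := 2) (by norm_num) (by norm_num) y hy)
    have a2 := abs_le.1 (prod3 (i := 1) (by norm_num) y hy)
    unfold Yd
    rw [abs_le]; constructor <;> linarith
  have hq := hs.q0_sup hL hx ht
  have := quart (ε := ε) (θ := θ) hL hD hε hθ (Real.sqrt_nonneg L) h4 (Real.sqrt_nonneg (AA L w t))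
    hAN (bb_nonneg L w t) (bb_le_N L w t)
    (hs.p_le hL (i := 0) (by norm_num) hx ht) (hs.p_le hL (i := 1) (by norm_num) hx ht)
    (hs.p_le hL (i := 2) (by norm_num) hx ht) (hs.p3_le hL hx ht)
    (q1 := Td 1 (pdx (pdx w)) x t) (q2 := Td 2 (pdx (pdx w)) x t) (q3 := Td 3 (pdx (pdx w)) x t)
    (w4 := pdx (pdx (pdx (pdx w))) x t)
    (Kp_bound (hF_sm hs.sm) hh hx) (Kp_bound (hF_sm hs.sm).pdt hh1 hx) (Jp_bound hh hx)
    (hs.Z_le hL hx ht) (Jp_bound hY hx) (hs.w3_sup hL hx ht)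
    (hq.trans (by
      have := aa_le_A L w 0 (by norm_num) t
      have := bb_nonneg L w t
      gcongr))
  rw [hA2, hN2] at this
  exact this

theorem eps_pos {L k : ℝ} (hL : 0 < L) (hk : 0 < k) : 0 < eps L k := by unfold eps; positivity
theorem tht_pos {L D k : ℝ} (hL : 0 < L) (hD : 0 < D) (hk : 0 < k) : 0 < tht L D k := by
  unfold tht; positivity

/-- The nonlinear constant. -/
noncomputable def Kc (L D k : ℝ) : ℝ := Cq L D (eps L k) (tht L D k) * (2 + L)

theorem Cq_pos {L D ε θ : ℝ} (hL : 0 < L) (hD : 0 < D) (hε : 0 < ε) (hθ : 0 < θ) :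
    0 < Cq L D ε θ := by unfold Cq; positivity

theorem Kc_pos {L D k : ℝ} (hL : 0 < L) (hD : 0 < D) (hk : 0 < k) : 0 < Kc L D k :=
  mul_pos (Cq_pos hL hD (eps_pos hL hk) (tht_pos hL hD hk)) (by linarith)

theorem Sol.F_deriv {L D k T : ℝ} {w : ℝ → ℝ → ℝ} (hs : Sol L D k T w) (hL : 0 < L) (hD : 0 < D)
    (hk : 0 < k) {t : ℝ} (ht : t ∈ Ioo (0:ℝ) T) :
    ∃ d, HasDerivAt (FF L D k w) d t ∧
      d ≤ -(eps L k * D) * aa L w 0 t ^ 2 - k / 2 * aa L w 1 t ^ 2 - k / 2 * aa L w 2 t ^ 2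
        - k * aa L w 3 t ^ 2 - tht L D k * D / 2 * bb L w t ^ 2
        + Kc L D k * (AA L w t * NN L w t) := by
  refine ⟨_, (ed_sm D k (eps L k) (tht L D k) hs.sm).int_dt 0 L t, ?_⟩
  obtain ⟨f, hf, hfe, hfi⟩ := hs.diss hL (eps L k) (tht L D k) ht
  rw [hfi]
  have ht' : t ∈ Ico (0:ℝ) T := ⟨ht.1.le, ht.2⟩
  have hε := eps_pos hL hk
  have hθ := tht_pos hL hD hk
  have h2 := hs.sm.pdx.pdx
  set ε := eps L k with hεd
  set θ := tht L D k with hθd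
  set C := Cq L D ε θ with hC
  set A := AA L w t with hA
  set N := NN L w t with hN
  have lin := int_lin (L := L) (((h2.Td 0).contx t).pow 2) (((h2.Td 1).contx t).pow 2)
    (((h2.Td 2).contx t).pow 2) (((h2.Td 3).contx t).pow 2) ((h2.pdx.pdx.contx t).pow 2)
    (ε * L ^ 3 * aa L w 1 t ^ 2 + θ / (2 * D) * L ^ 3 * aa L w 2 t ^ 2 + C * (A * N))
    (-(ε * D) + C * (A + N)) (-k + C * (A + N)) (-k + C * (A + N)) (-k + C * A)
    (-(θ * D / 2) + C * A)
  simp only [Pi.pow_apply] at lin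
  have mono : ∫ x in (0:ℝ)..L, f x ≤ ∫ x in (0:ℝ)..L,
      (ε * L ^ 3 * aa L w 1 t ^ 2 + θ / (2 * D) * L ^ 3 * aa L w 2 t ^ 2 + C * (A * N)
      + (-(ε * D) + C * (A + N)) * Td 0 (pdx (pdx w)) x t ^ 2
      + (-k + C * (A + N)) * Td 1 (pdx (pdx w)) x t ^ 2
      + (-k + C * (A + N)) * Td 2 (pdx (pdx w)) x t ^ 2
      + (-k + C * A) * Td 3 (pdx (pdx w)) x t ^ 2
      + (-(θ * D / 2) + C * A) * pdx (pdx (pdx (pdx w))) x t ^ 2) := by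
    apply intervalIntegral.integral_mono_on hL.le (hf.intervalIntegrable _ _)
    · apply Continuous.intervalIntegrable
      have e0 := (h2.Td 0).contx t
      have e1 := (h2.Td 1).contx t
      have e2 := (h2.Td 2).contx t
      have e3 := (h2.Td 3).contx t
      have e4 := h2.pdx.pdx.contx t
      fun_prop
    · intro x hx
      rw [hfe x hx, dens]
      have a1 := (abs_le.1 (hs.Q_le hL hD hε hθ hx ht')).1
      have a2 := mul_le_mul_of_nonneg_left (hs.v_sup hL 1 hx ht') hε.le
      have a3 := mul_le_mul_of_nonneg_left (hs.v_sup hL 2 hx ht')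
        (show 0 ≤ θ / (2 * D) by positivity)
      have a4 : -(θ * (Td 2 w x t * pdx (pdx (pdx (pdx w))) x t))
          ≤ θ / (2 * D) * Td 2 w x t ^ 2 + θ * D / 2 * pdx (pdx (pdx (pdx w))) x t ^ 2 := by
        have : θ / (2 * D) * Td 2 w x t ^ 2 + θ * D / 2 * pdx (pdx (pdx (pdx w))) x t ^ 2
            + (θ * (Td 2 w x t * pdx (pdx (pdx (pdx w))) x t))
            = θ / (2 * D) * (Td 2 w x t + D * pdx (pdx (pdx (pdx w))) x t) ^ 2 := by
          field_simp; ring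
        have : 0 ≤ θ / (2 * D) * (Td 2 w x t + D * pdx (pdx (pdx (pdx w))) x t) ^ 2 := by
          positivity
        linarith
      rw [Td_zero]
      linarith
  rw [lin, ← aa_sq hL w 0, ← aa_sq hL w 1, ← aa_sq hL w 2, ← aa_sq hL w 3, ← bb_sq hL] at mono
  have e1 : L * (ε * L ^ 3 * aa L w 1 t ^ 2) = k / 2 * aa L w 1 t ^ 2 := by
    rw [hεd, eps]; field_simp
  have e2 : L * (θ / (2 * D) * L ^ 3 * aa L w 2 t ^ 2) = k / 2 * aa L w 2 t ^ 2 := by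
    rw [hθd, tht]; field_simp
  have eA : A = aa L w 0 t ^ 2 + aa L w 1 t ^ 2 + aa L w 2 t ^ 2 := rfl
  have eN : N = A + aa L w 3 t ^ 2 + bb L w t ^ 2 := rfl
  have e3 : C * (A + N) * aa L w 0 t ^ 2 + C * (A + N) * aa L w 1 t ^ 2
      + C * (A + N) * aa L w 2 t ^ 2 + C * A * aa L w 3 t ^ 2 + C * A * bb L w t ^ 2
      = C * (A * N) * 2 := by
    have : C * (A + N) * aa L w 0 t ^ 2 + C * (A + N) * aa L w 1 t ^ 2
      + C * (A + N) * aa L w 2 t ^ 2 + C * A * aa L w 3 t ^ 2 + C * A * bb L w t ^ 2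
      = C * N * (aa L w 0 t ^ 2 + aa L w 1 t ^ 2 + aa L w 2 t ^ 2) + C * A *
        (aa L w 0 t ^ 2 + aa L w 1 t ^ 2 + aa L w 2 t ^ 2 + aa L w 3 t ^ 2 + bb L w t ^ 2) := by
      ring
    rw [this, ← eA, ← eN]; ring
  have e4 : Kc L D k * (A * N) = C * (A * N) * 2 + L * (C * (A * N)) := by
    unfold Kc; ring
  rw [e4]
  linarith

noncomputable def VV (L : ℝ) (w : ℝ → ℝ → ℝ) (i : ℕ) (t : ℝ) : ℝ :=
  ∫ x in (0:ℝ)..L, (Td i w x t) ^ 2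
noncomputable def ZZ (L : ℝ) (w : ℝ → ℝ → ℝ) (t : ℝ) : ℝ := ∫ x in (0:ℝ)..L, (Zf w x t) ^ 2

theorem VV_nonneg {L : ℝ} (hL : 0 < L) (w : ℝ → ℝ → ℝ) (i : ℕ) (t : ℝ) : 0 ≤ VV L w i t :=
  intervalIntegral.integral_nonneg hL.le fun _ _ => sq_nonneg _
theorem ZZ_nonneg {L : ℝ} (hL : 0 < L) (w : ℝ → ℝ → ℝ) (t : ℝ) : 0 ≤ ZZ L w t :=
  intervalIntegral.integral_nonneg hL.le fun _ _ => sq_nonneg _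

theorem Sol.VV_le {L D k T : ℝ} {w : ℝ → ℝ → ℝ} (hs : Sol L D k T w) (hL : 0 < L) (i : ℕ)
    {t : ℝ} (ht : t ∈ Ico (0:ℝ) T) : VV L w i t ≤ L ^ 4 * aa L w i t ^ 2 := by
  have := int_le_const hL.le (((hs.sm.Td i).contx t).pow 2) (fun x hx => hs.v_sup hL i hx ht)
  calc VV L w i t ≤ _ := this
    _ = _ := by ring

theorem int_sq_le {L C : ℝ} (hL : 0 < L) {f : ℝ → ℝ} (hf : Continuous f)
    (h : ∀ x ∈ Icc (0:ℝ) L, |f x| ≤ C) : ∫ x in (0:ℝ)..L, f x ^ 2 ≤ L * C ^ 2 :=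
  int_le_const hL.le (hf.pow 2) (fun x hx => by
    have := h x hx
    rw [← sq_abs]; gcongr)

theorem int_mul_sq_le {L C : ℝ} (hL : 0 < L) {f g : ℝ → ℝ} (hf : Continuous f) (hg : Continuous g)
    (h : ∀ x ∈ Icc (0:ℝ) L, |f x| ≤ C) :
    ∫ x in (0:ℝ)..L, (f x * g x) ^ 2 ≤ C ^ 2 * ∫ x in (0:ℝ)..L, g x ^ 2 := by
  rw [← intervalIntegral.integral_const_mul]
  apply intervalIntegral.integral_mono_on hL.le
  · exact ((hf.mul hg).pow 2).intervalIntegrable _ _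
  · exact ((hg.pow 2).const_mul _).intervalIntegrable _ _
  · intro x hx
    have := h x hx
    rw [mul_pow, ← sq_abs (f x)]; gcongr

theorem Sol.ZZ_le {L D k T : ℝ} {w : ℝ → ℝ → ℝ} (hs : Sol L D k T w) (hL : 0 < L)
    {t : ℝ} (ht : t ∈ Ico (0:ℝ) T) : ZZ L w t ≤ L ^ 5 * (AA L w t * NN L w t) := by
  have := int_sq_le hL ((Zf_sm hs.sm).contx t) (fun x hx => hs.Z_le hL hx ht)
  have hA2 : √(AA L w t) ^ 2 = AA L w t := Real.sq_sqrt (AA_nonneg L w t)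
  have hN2 : √(NN L w t) ^ 2 = NN L w t := Real.sq_sqrt (NN_nonneg L w t)
  calc ZZ L w t ≤ _ := this
    _ = L ^ 5 * (√(AA L w t) ^ 2 * √(NN L w t) ^ 2) := by ring
    _ = _ := by rw [hA2, hN2]

theorem FF_eq {L D k : ℝ} (hL : 0 < L) {w : ℝ → ℝ → ℝ} (hw : Sm w) (t : ℝ) :
    FF L D k w t = 1 / 2 * VV L w 1 t + (D / 2 + eps L k * k / 2) * aa L w 0 t ^ 2
      + eps L k * (∫ x in (0:ℝ)..L, w x t * Td 1 w x t)
      + 1 / 2 * VV L w 2 t + D / 2 * aa L w 1 t ^ 2 + 1 / 2 * VV L w 3 t + D / 2 * aa L w 2 t ^ 2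
      + 1 / 2 * ZZ L w t + tht L D k * k / 2 * bb L w t ^ 2 := by
  have I : ∀ {f : ℝ → ℝ}, Continuous f → IntervalIntegrable f volume 0 L :=
    fun h => h.intervalIntegrable _ _
  have h2 := hw.pdx.pdx
  have u0 := hw.contx t
  have u1 := (hw.Td 1).contx t
  have u2 := (hw.Td 2).contx t
  have u3 := (hw.Td 3).contx t
  have e0 := (h2.Td 0).contx t
  have e1 := (h2.Td 1).contx t
  have e2 := (h2.Td 2).contx t
  have e3 := (Zf_sm hw).contx t
  have e4 := h2.pdx.pdx.contx t
  unfold FF ed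
  simp only [Td_zero] at *
  rw [intervalIntegral.integral_add (I (by fun_prop)) (I (by fun_prop)),
    intervalIntegral.integral_add (I (by fun_prop)) (I (by fun_prop)),
    intervalIntegral.integral_add (I (by fun_prop)) (I (by fun_prop)),
    intervalIntegral.integral_add (I (by fun_prop)) (I (by fun_prop)),
    intervalIntegral.integral_add (I (by fun_prop)) (I (by fun_prop)),
    intervalIntegral.integral_add (I (by fun_prop)) (I (by fun_prop)),
    intervalIntegral.integral_add (I (by fun_prop)) (I (by fun_prop)),
    intervalIntegral.integral_add (I (by fun_prop)) (I (by fun_prop)),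
    intervalIntegral.integral_add (I (by fun_prop)) (I (by fun_prop))]
  simp only [intervalIntegral.integral_const_mul]
  rw [aa_sq hL, aa_sq hL, aa_sq hL, bb_sq hL]
  simp only [VV, ZZ, Td_zero]
  ring

theorem Sol.cross {L D k T : ℝ} {w : ℝ → ℝ → ℝ} (hs : Sol L D k T w) (hL : 0 < L) (hk : 0 < k)
    {t : ℝ} (ht : t ∈ Ico (0:ℝ) T) : |eps L k * (∫ x in (0:ℝ)..L, w x t * Td 1 w x t)|
      ≤ 1 / 4 * VV L w 1 t + eps L k * k / 2 * aa L w 0 t ^ 2 := by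
  have hε := eps_pos hL hk
  have h0 := hs.VV_le hL 0 ht
  have u0 := hs.sm.contx t
  have u1 := (hs.sm.Td 1).contx t
  have key : ∀ s : ℝ, s ^ 2 = 1 → s * (eps L k * (∫ x in (0:ℝ)..L, w x t * Td 1 w x t))
      ≤ 1 / 4 * VV L w 1 t + eps L k ^ 2 * VV L w 0 t := by
    intro s hs1
    have : ∫ x in (0:ℝ)..L, (1 / 4 * Td 1 w x t ^ 2 + eps L k ^ 2 * Td 0 w x t ^ 2)
        ≥ ∫ x in (0:ℝ)..L, s * (eps L k * (w x t * Td 1 w x t)) := by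
      apply intervalIntegral.integral_mono_on hL.le
      · exact Continuous.intervalIntegrable (by fun_prop) _ _
      · apply Continuous.intervalIntegrable
        simp only [Td_zero]
        fun_prop
      · intro x hx
        have := sq_nonneg (1 / 2 * Td 1 w x t - s * (eps L k * w x t))
        have e : (1 / 2 * Td 1 w x t - s * (eps L k * w x t)) ^ 2 = 1 / 4 * Td 1 w x t ^ 2
          + s ^ 2 * (eps L k ^ 2 * w x t ^ 2) - s * (eps L k * (w x t * Td 1 w x t)) := by ring
        rw [e, hs1] at this
        rw [Td_zero]; linarith
    rw [intervalIntegral.integral_add, intervalIntegral.integral_const_mul,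
      intervalIntegral.integral_const_mul, intervalIntegral.integral_const_mul,
      intervalIntegral.integral_const_mul] at this
    · exact this
    · exact Continuous.intervalIntegrable (by fun_prop) _ _
    · apply Continuous.intervalIntegrable
      simp only [Td_zero]
      fun_prop
  have k1 := key 1 (by norm_num)
  have k2 := key (-1) (by norm_num)
  have h3 := mul_le_mul_of_nonneg_left h0 (sq_nonneg (eps L k))
  have e : eps L k ^ 2 * (L ^ 4 * aa L w 0 t ^ 2) = eps L k * k / 2 * aa L w 0 t ^ 2 := by
    unfold eps; field_simp
  rw [e] at h3
  rw [abs_le]; constructor <;> linarith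

theorem Sol.F_lower {L D k T : ℝ} {w : ℝ → ℝ → ℝ} (hs : Sol L D k T w) (hL : 0 < L) (hk : 0 < k)
    {t : ℝ} (ht : t ∈ Ico (0:ℝ) T) :
    1 / 4 * VV L w 1 t + 1 / 2 * VV L w 2 t + 1 / 2 * VV L w 3 t + 1 / 2 * ZZ L w t
      + D / 2 * AA L w t + tht L D k * k / 2 * bb L w t ^ 2 ≤ FF L D k w t := by
  have := (abs_le.1 (hs.cross hL hk ht)).1
  rw [FF_eq hL hs.sm]
  unfold AA
  linarith

theorem Sol.F_upper {L D k T : ℝ} {w : ℝ → ℝ → ℝ} (hs : Sol L D k T w) (hL : 0 < L) (hk : 0 < k)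
    {t : ℝ} (ht : t ∈ Ico (0:ℝ) T) :
    FF L D k w t ≤ 3 / 4 * VV L w 1 t + 1 / 2 * VV L w 2 t + 1 / 2 * VV L w 3 t + 1 / 2 * ZZ L w t
      + (D / 2 + eps L k * k) * aa L w 0 t ^ 2 + D / 2 * aa L w 1 t ^ 2 + D / 2 * aa L w 2 t ^ 2
       + tht L D k * k / 2 * bb L w t ^ 2 := by
  have := (abs_le.1 (hs.cross hL hk ht)).2
  rw [FF_eq hL hs.sm]
  linarith

noncomputable def C2 (L D k : ℝ) : ℝ :=
  2 * L ^ 4 + L ^ 5 + 2 * D + eps L k * k + tht L D k * k / 2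

theorem C2_pos {L D k : ℝ} (hL : 0 < L) (hD : 0 < D) (hk : 0 < k) : 0 < C2 L D k := by
  have := eps_pos hL hk
  have := tht_pos hL hD hk
  unfold C2; positivity

theorem Sol.F_le_N {L D k T : ℝ} {w : ℝ → ℝ → ℝ} (hs : Sol L D k T w) (hL : 0 < L) (hD : 0 < D)
    (hk : 0 < k) {t : ℝ} (ht : t ∈ Ico (0:ℝ) T) (hA : AA L w t ≤ 1) :
    FF L D k w t ≤ C2 L D k * NN L w t := by
  have h0 := hs.F_upper hL hk ht
  have h1 := hs.VV_le hL 1 ht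
  have h2 := hs.VV_le hL 2 ht
  have h3 := hs.VV_le hL 3 ht
  have h4 := hs.ZZ_le hL ht
  have hN := NN_nonneg L w t
  have h5 : AA L w t * NN L w t ≤ NN L w t := by nlinarith
  have h6 := mul_le_mul_of_nonneg_left h5 (pow_pos hL 5).le
  have n0 := sq_nonneg (aa L w 0 t)
  have n1 := sq_nonneg (aa L w 1 t)
  have n2 := sq_nonneg (aa L w 2 t)
  have n3 := sq_nonneg (aa L w 3 t)
  have n4 := sq_nonneg (bb L w t)
  have hε := mul_pos (eps_pos hL hk) hk
  have hθ := mul_pos (tht_pos hL hD hk) hk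
  have eN : NN L w t = aa L w 0 t ^ 2 + aa L w 1 t ^ 2 + aa L w 2 t ^ 2 + aa L w 3 t ^ 2
    + bb L w t ^ 2 := rfl
  have L4 := pow_pos hL 4
  have L5 := pow_pos hL 5
  have m : ∀ {c x : ℝ}, 0 ≤ c → x ≤ NN L w t → c * x ≤ c * NN L w t := fun hc hx =>
    mul_le_mul_of_nonneg_left hx hc
  have m1 := m (c := L ^ 4) (x := aa L w 1 t ^ 2) L4.le (by linarith)
  have m2 := m (c := L ^ 4) (x := aa L w 2 t ^ 2) L4.le (by linarith)
  have m3 := m (c := L ^ 4) (x := aa L w 3 t ^ 2) L4.le (by linarith)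
  have m4 := m (c := D / 2 + eps L k * k) (x := aa L w 0 t ^ 2) (by linarith) (by linarith)
  have m5 := m (c := D / 2) (x := aa L w 1 t ^ 2) (by linarith) (by linarith)
  have m6 := m (c := D / 2) (x := aa L w 2 t ^ 2) (by linarith) (by linarith)
  have m7 := m (c := tht L D k * k / 2) (x := bb L w t ^ 2) (by linarith) (by linarith)
  have m8 := mul_nonneg L4.le hN
  have m9 := mul_nonneg L5.le hN
  have m10 := mul_nonneg hD.le hN
  unfold C2
  linarith

noncomputable def cc (L D k : ℝ) : ℝ := min (eps L k * D) (min (k / 2) (tht L D k * D / 2))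
theorem cc_pos {L D k : ℝ} (hL : 0 < L) (hD : 0 < D) (hk : 0 < k) : 0 < cc L D k := by
  have := eps_pos hL hk
  have := tht_pos hL hD hk
  unfold cc
  refine lt_min (by positivity) (lt_min (by positivity) (by positivity))

noncomputable def dl (L D k : ℝ) : ℝ := min (D / 2) (cc L D k * D / (4 * Kc L D k))
theorem dl_pos {L D k : ℝ} (hL : 0 < L) (hD : 0 < D) (hk : 0 < k) : 0 < dl L D k := by
  have := cc_pos hL hD hk
  have := Kc_pos hL hD hk
  unfold dl
  refine lt_min (by positivity) (by positivity)

noncomputable def om (L D k : ℝ) : ℝ := cc L D k / (4 * C2 L D k)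
theorem om_pos {L D k : ℝ} (hL : 0 < L) (hD : 0 < D) (hk : 0 < k) : 0 < om L D k := by
  have := cc_pos hL hD hk
  have := C2_pos hL hD hk
  unfold om
  positivity

theorem Sol.A_le_F {L D k T : ℝ} {w : ℝ → ℝ → ℝ} (hs : Sol L D k T w) (hL : 0 < L) (hD : 0 < D)
    (hk : 0 < k) {t : ℝ} (ht : t ∈ Ico (0:ℝ) T) : D / 2 * AA L w t ≤ FF L D k w t := by
  have h0 := hs.F_lower hL hk ht
  have h1 := VV_nonneg hL w 1 t
  have h2 := VV_nonneg hL w 2 t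
  have h3 := VV_nonneg hL w 3 t
  have h4 := ZZ_nonneg hL w t
  have := mul_nonneg (mul_pos (tht_pos hL hD hk) hk).le (sq_nonneg (bb L w t))
  linarith

theorem Sol.A_le_one {L D k T : ℝ} {w : ℝ → ℝ → ℝ} (hs : Sol L D k T w) (hL : 0 < L) (hD : 0 < D)
    (hk : 0 < k) {t : ℝ} (ht : t ∈ Ico (0:ℝ) T) (hF : FF L D k w t ≤ dl L D k) :
    AA L w t ≤ 1 := by
  have h0 := hs.A_le_F hL hD hk ht
  have h1 : dl L D k ≤ D / 2 := min_le_left _ _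
  have : D / 2 * AA L w t ≤ D / 2 * 1 := by linarith
  exact le_of_mul_le_mul_left this (by linarith)

theorem Sol.F_decay_rate {L D k T : ℝ} {w : ℝ → ℝ → ℝ} (hs : Sol L D k T w) (hL : 0 < L)
    (hD : 0 < D) (hk : 0 < k) {t : ℝ} (ht : t ∈ Ioo (0:ℝ) T) (hF : FF L D k w t ≤ dl L D k)
    {d : ℝ} (hd : HasDerivAt (FF L D k w) d t) : d ≤ -(2 * om L D k) * FF L D k w t := by
  obtain ⟨d', hd', hle⟩ := hs.F_deriv hL hD hk ht
  obtain rfl := hd.unique hd'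
  have ht' : t ∈ Ico (0:ℝ) T := ⟨ht.1.le, ht.2⟩
  have hA1 := hs.A_le_one hL hD hk ht' hF
  have hN := hs.F_le_N hL hD hk ht' hA1
  have hN0 := NN_nonneg L w t
  have hK := Kc_pos hL hD hk
  have hC := C2_pos hL hD hk
  have hc := cc_pos hL hD hk
  have h1 : Kc L D k * AA L w t ≤ cc L D k / 2 := by
    have a := hs.A_le_F hL hD hk ht'
    have b : dl L D k ≤ cc L D k * D / (4 * Kc L D k) := min_le_right _ _
    have e : D / 2 * AA L w t ≤ cc L D k * D / (4 * Kc L D k) := by linarith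
    rw [le_div_iff₀ (by positivity)] at e
    have : D * (Kc L D k * AA L w t) ≤ D * (cc L D k / 2) := by linarith
    exact le_of_mul_le_mul_left this hD
  have h2 := mul_le_mul_of_nonneg_right h1 hN0
  have c1 : cc L D k ≤ eps L k * D := min_le_left _ _
  have c2 : cc L D k ≤ k / 2 := (min_le_right _ _).trans (min_le_left _ _)
  have c3 : cc L D k ≤ tht L D k * D / 2 := (min_le_right _ _).trans (min_le_right _ _)
  have m0 := mul_le_mul_of_nonneg_right c1 (sq_nonneg (aa L w 0 t))
  have m1 := mul_le_mul_of_nonneg_right c2 (sq_nonneg (aa L w 1 t))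
  have m2 := mul_le_mul_of_nonneg_right c2 (sq_nonneg (aa L w 2 t))
  have m3 := mul_le_mul_of_nonneg_right (c2.trans (by linarith : k / 2 ≤ k))
    (sq_nonneg (aa L w 3 t))
  have m4 := mul_le_mul_of_nonneg_right c3 (sq_nonneg (bb L w t))
  have eN : cc L D k * NN L w t = cc L D k * (aa L w 0 t ^ 2 + aa L w 1 t ^ 2 + aa L w 2 t ^ 2
    + aa L w 3 t ^ 2 + bb L w t ^ 2) := rfl
  have h3 : d ≤ -(cc L D k / 2) * NN L w t := by linarith
  have h4 : 2 * om L D k * FF L D k w t ≤ cc L D k / 2 * NN L w t := by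
    have := mul_le_mul_of_nonneg_left hN (show 0 ≤ 2 * om L D k from
      mul_nonneg (by norm_num) (om_pos hL hD hk).le)
    have e : 2 * om L D k * (C2 L D k * NN L w t) = cc L D k / 2 * NN L w t := by
      unfold om; field_simp; ring
    linarith
  linarith

theorem Sol.F_decay {L D k T : ℝ} {w : ℝ → ℝ → ℝ} (hs : Sol L D k T w) (hL : 0 < L)
    (hD : 0 < D) (hk : 0 < k) (h0 : FF L D k w 0 < dl L D k) {t : ℝ} (ht : t ∈ Ico (0:ℝ) T) :
    FF L D k w t ≤ dl L D k * Real.exp (-om L D k * t) := by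
  have hder : ∀ s, HasDerivAt (FF L D k w)
      (∫ x in (0:ℝ)..L, pdt (ed D k (eps L k) (tht L D k) w) x s) s := fun s =>
    (ed_sm D k (eps L k) (tht L D k) hs.sm).int_dt 0 L s
  have hδ := dl_pos hL hD hk
  have hω := om_pos hL hD hk
  have hB : ∀ s, HasDerivAt (fun s => dl L D k * Real.exp (-om L D k * s))
      (-om L D k * (dl L D k * Real.exp (-om L D k * s))) s := by
    intro s
    have := (((hasDerivAt_id s).const_mul (-om L D k)).exp).const_mul (dl L D k)
    refine this.congr_deriv ?_
    simp; ring
  refine image_le_of_deriv_right_lt_deriv_boundary (a := 0) (b := t)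
    (fun s _ => (hder s).continuousAt.continuousWithinAt)
    (fun s _ => (hder s).hasDerivWithinAt) (by simpa using h0.le) hB ?_ ⟨ht.1, le_rfl⟩
  intro s hs1 heq
  have hpos : 0 < dl L D k * Real.exp (-om L D k * s) := by positivity
  rcases hs1.1.eq_or_lt with h | h
  · rw [← h] at heq
    simp at heq
    linarith
  · have hle : FF L D k w s ≤ dl L D k := by
      rw [heq]
      have : Real.exp (-om L D k * s) ≤ 1 := Real.exp_le_one_iff.2 (by nlinarith)
      nlinarith
    have := hs.F_decay_rate hL hD hk ⟨h, hs1.2.trans ht.2⟩ hle (hder s)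
    rw [heq] at this
    nlinarith [mul_pos hω hpos]

theorem sq_half_bound {L A a : ℝ} (hL : 0 < L) (hA : 0 ≤ A) (h : a ≤ (√L * √A) ^ 2) : a ≤ L * A := by
  rwa [mul_pow, Real.sq_sqrt hL.le, Real.sq_sqrt hA] at h

theorem utttF_eq {w : ℝ → ℝ → ℝ} (hw : Sm w) (x t : ℝ) : utttF w x t =
    -(Zf w x t + Jp (fun x t => 3 * (Td 1 (pdx w) x t * Td 2 (pdx w) x t)) x t) := by
  have := Jp_add (h := fun ξ t => 3 * pdt (pdx w) ξ t * pdt (pdt (pdx w)) ξ t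
      + pdx w ξ t * pdt (pdt (pdt (pdx w))) ξ t) (hw.pdx.mul (hw.pdx.Td 3))
      (((hw.pdx.Td 1).mul (hw.pdx.Td 2)).cmul 3) (fun x t => by
        show 3 * Td 1 (pdx w) x t * Td 2 (pdx w) x t + pdx w x t * Td 3 (pdx w) x t = _
        ring) x t
  unfold Zf
  rw [← this]
  rfl

theorem utttF_sm {w : ℝ → ℝ → ℝ} (hw : Sm w) : Sm (utttF w) := by
  have : utttF w = fun x t =>
    -(Zf w x t + Jp (fun x t => 3 * (Td 1 (pdx w) x t * Td 2 (pdx w) x t)) x t) := by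
    funext x t; exact utttF_eq hw x t
  rw [this]
  exact ((Zf_sm hw).add ((((hw.pdx.Td 1).mul (hw.pdx.Td 2)).cmul 3).J)).neg

theorem Sol.J12 {L D k T : ℝ} {w : ℝ → ℝ → ℝ} (hs : Sol L D k T w) (hL : 0 < L)
    {x t : ℝ} (hx : x ∈ Icc (0:ℝ) L) (ht : t ∈ Ico (0:ℝ) T) :
    Jp (fun x t => 3 * (Td 1 (pdx w) x t * Td 2 (pdx w) x t)) x t ^ 2
      ≤ 9 * L ^ 4 * (aa L w 1 t ^ 2 * aa L w 2 t ^ 2) := by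
  have h4 : √L ^ 2 = L := Real.sq_sqrt hL.le
  have : |Jp (fun x t => 3 * (Td 1 (pdx w) x t * Td 2 (pdx w) x t)) x t|
      ≤ L * (3 * (L * (aa L w 1 t * aa L w 2 t))) := by
    refine Jp_bound (fun y hy => ?_) hx
    have := abs_mul_le' (hs.p_sup hL 1 hy ht) (hs.p_sup hL 2 hy ht)
    rw [abs_mul, abs_of_pos (by norm_num : (0:ℝ) < 3)]
    have e : √L * aa L w 1 t * (√L * aa L w 2 t) = L * (aa L w 1 t * aa L w 2 t) := by
      rw [show √L * aa L w 1 t * (√L * aa L w 2 t) = √L ^ 2 * (aa L w 1 t * aa L w 2 t) by ring, h4]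
    rw [e] at this
    linarith
  rw [← sq_abs]
  calc _ ≤ (L * (3 * (L * (aa L w 1 t * aa L w 2 t)))) ^ 2 := by gcongr
    _ = _ := by ring

theorem int_sq_two {L C : ℝ} (hL : 0 < L) {f g : ℝ → ℝ} (hf : Continuous f) (hg : Continuous g)
    (h : ∀ x ∈ Icc (0:ℝ) L, f x ^ 2 ≤ 2 * g x ^ 2 + C) :
    ∫ x in (0:ℝ)..L, f x ^ 2 ≤ 2 * (∫ x in (0:ℝ)..L, g x ^ 2) + L * C := by
  have : ∫ x in (0:ℝ)..L, f x ^ 2 ≤ ∫ x in (0:ℝ)..L, (2 * g x ^ 2 + C) := by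
    apply intervalIntegral.integral_mono_on hL.le
    · exact (hf.pow 2).intervalIntegrable _ _
    · exact (((hg.pow 2).const_mul 2).add continuous_const).intervalIntegrable _ _
    · exact h
  have I : ∀ {f : ℝ → ℝ}, Continuous f → IntervalIntegrable f volume 0 L :=
    fun h => h.intervalIntegrable _ _
  rw [intervalIntegral.integral_add (I (by fun_prop)) (I (by fun_prop)),
    intervalIntegral.integral_const_mul] at this
  simpa using this

theorem Sol.ttt_le {L D k T : ℝ} {w : ℝ → ℝ → ℝ} (hs : Sol L D k T w) (hL : 0 < L)
    {t : ℝ} (ht : t ∈ Ico (0:ℝ) T) :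
    ∫ x in (0:ℝ)..L, (utttF w x t) ^ 2
      ≤ 2 * ZZ L w t + L * (18 * L ^ 4 * (aa L w 1 t ^ 2 * aa L w 2 t ^ 2)) := by
  refine int_sq_two hL ((utttF_sm hs.sm).contx t) ((Zf_sm hs.sm).contx t) fun x hx => ?_
  have := hs.J12 hL hx ht
  rw [utttF_eq hs.sm]
  nlinarith [sq_nonneg (Zf w x t - Jp (fun x t => 3 * (Td 1 (pdx w) x t * Td 2 (pdx w) x t)) x t)]

theorem Sol.ZZ_le_ttt {L D k T : ℝ} {w : ℝ → ℝ → ℝ} (hs : Sol L D k T w) (hL : 0 < L)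
    {t : ℝ} (ht : t ∈ Ico (0:ℝ) T) :
    ZZ L w t ≤ 2 * (∫ x in (0:ℝ)..L, (utttF w x t) ^ 2)
      + L * (18 * L ^ 4 * (aa L w 1 t ^ 2 * aa L w 2 t ^ 2)) := by
  refine int_sq_two hL ((Zf_sm hs.sm).contx t) ((utttF_sm hs.sm).contx t) fun x hx => ?_
  have := hs.J12 hL hx ht
  have e := utttF_eq hs.sm x t
  have e2 : Zf w x t = -(utttF w x t
    + Jp (fun x t => 3 * (Td 1 (pdx w) x t * Td 2 (pdx w) x t)) x t) := by linarith
  rw [e2]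
  nlinarith [sq_nonneg (utttF w x t
    - Jp (fun x t => 3 * (Td 1 (pdx w) x t * Td 2 (pdx w) x t)) x t)]

/-- The total energy. -/
noncomputable def XX (L : ℝ) (w : ℝ → ℝ → ℝ) (t : ℝ) : ℝ :=
  X0 L w t + X1 L w t + X2 L w t + X3 L w t

noncomputable def C3 (L D k : ℝ) : ℝ :=
  12 + (2 + 9 * L + 23 * L ^ 5) * (2 / D) + (1 + L) * (2 / (tht L D k * k))

theorem C3_pos {L D k : ℝ} (hL : 0 < L) (hD : 0 < D) (hk : 0 < k) : 0 < C3 L D k := by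
  have := tht_pos hL hD hk
  unfold C3; positivity

theorem Sol.X_le {L D k T : ℝ} {w : ℝ → ℝ → ℝ} (hs : Sol L D k T w) (hL : 0 < L)
    {t : ℝ} (ht : t ∈ Ico (0:ℝ) T) (hA1 : AA L w t ≤ 1) :
    XX L w t ≤ VV L w 1 t + VV L w 2 t + VV L w 3 t + 2 * ZZ L w t
      + (2 + 9 * L + 23 * L ^ 5) * AA L w t + (1 + L) * bb L w t ^ 2 := by
  have hA0 := AA_nonneg L w t
  have hA2 : √(AA L w t) ^ 2 = AA L w t := Real.sq_sqrt hA0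
  have h4 : √L ^ 2 = L := Real.sq_sqrt hL.le
  have h2 := hs.sm.pdx.pdx
  have n0 := sq_nonneg (aa L w 0 t)
  have n1 := sq_nonneg (aa L w 1 t)
  have n2 := sq_nonneg (aa L w 2 t)
  have n3 := sq_nonneg (bb L w t)
  have eA : AA L w t = aa L w 0 t ^ 2 + aa L w 1 t ^ 2 + aa L w 2 t ^ 2 := rfl
  have hsq : (√L * √(AA L w t)) ^ 2 = L * AA L w t := by rw [mul_pow, h4, hA2]
  have hAA : AA L w t * AA L w t ≤ AA L w t := by nlinarith
  have hLA : L * AA L w t ≤ L := by nlinarith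
  -- products
  have P : ∀ {i : ℕ}, i ≤ 2 → ∀ {g : ℝ → ℝ}, Continuous g →
      ∫ x in (0:ℝ)..L, (Td i (pdx w) x t * g x) ^ 2
        ≤ L * AA L w t * ∫ x in (0:ℝ)..L, g x ^ 2 := by
    intro i hi g hg
    have := int_mul_sq_le hL ((hs.sm.pdx.Td i).contx t) hg (fun x hx => hs.p_le hL hi hx ht)
    rwa [hsq] at this
  have Pq : ∀ {i j : ℕ}, i ≤ 2 → j ≤ 2 →
      ∫ x in (0:ℝ)..L, (Td i (pdx w) x t * Td j (pdx (pdx w)) x t) ^ 2 ≤ L * AA L w t := by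
    intro i j hi hj
    have h := P hi ((h2.Td j).contx t)
    rw [← aa_sq hL w j t] at h
    have : aa L w j t ^ 2 ≤ AA L w t := by interval_cases j <;> linarith
    have : L * AA L w t * aa L w j t ^ 2 ≤ L * AA L w t * 1 := by
      gcongr; linarith
    linarith
  have J : ∀ {f : ℝ → ℝ → ℝ} {c : ℝ}, Sm f → (∀ y ∈ Icc (0:ℝ) L, |f y t| ≤ c * L * AA L w t) →
      ∫ x in (0:ℝ)..L, (-Jp f x t) ^ 2 ≤ c ^ 2 * L ^ 5 * AA L w t := by
    intro f c hf h
    have h1 := int_sq_le hL (hf.J.contx t) (fun x hx => Jp_bound h hx)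
    simp only [neg_sq]
    have e : L * (L * (c * L * AA L w t)) ^ 2 = c ^ 2 * L ^ 5 * (AA L w t * AA L w t) := by ring
    rw [e] at h1
    refine h1.trans ?_
    gcongr
  have prod : ∀ {i j : ℕ}, i ≤ 2 → j ≤ 2 → ∀ y ∈ Icc (0:ℝ) L,
      |Td i (pdx w) y t * Td j (pdx w) y t| ≤ L * AA L w t := by
    intro i j hi hj y hy
    have := abs_mul_le' (hs.p_le hL hi hy ht) (hs.p_le hL hj hy ht)
    rwa [← sq, hsq] at this
  have t1 : ∫ x in (0:ℝ)..L, (pdx w x t * pdx (pdx w) x t) ^ 2 ≤ L * AA L w t :=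
    Pq (i := 0) (j := 0) (by norm_num) (by norm_num)
  have t2 : ∫ x in (0:ℝ)..L, (utF w x t) ^ 2 ≤ 1 ^ 2 * L ^ 5 * AA L w t := by
    refine J (f := fun x t => pdx w x t * Td 1 (pdx w) x t) (hs.sm.pdx.mul (hs.sm.pdx.Td 1)) ?_
    intro y hy
    have := prod (i := 0) (j := 1) (by norm_num) (by norm_num) y hy
    rw [Td_zero] at this
    linarith
  have t3 : ∫ x in (0:ℝ)..L, (pdt (pdx w) x t * pdx (pdx w) x t) ^ 2 ≤ L * AA L w t :=
    Pq (i := 1) (j := 0) (by norm_num) (by norm_num)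
  have t4 : ∫ x in (0:ℝ)..L, (pdx w x t * pdt (pdx (pdx w)) x t) ^ 2 ≤ L * AA L w t :=
    Pq (i := 0) (j := 1) (by norm_num) (by norm_num)
  have t5 : ∫ x in (0:ℝ)..L, (uttF w x t) ^ 2 ≤ 2 ^ 2 * L ^ 5 * AA L w t := by
    refine J (f := hF w) (hF_sm hs.sm) ?_
    intro y hy
    have a1 := abs_le.1 (prod (i := 1) (j := 1) (by norm_num) (by norm_num) y hy)
    have a2 := abs_le.1 (prod (i := 0) (j := 2) (by norm_num) (by norm_num) y hy)
    rw [Td_zero] at a2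
    unfold hF
    rw [abs_le]; constructor <;> linarith
  have t6 : ∫ x in (0:ℝ)..L, (pdx w x t * pdx (pdx (pdx (pdx w))) x t) ^ 2 ≤ L * bb L w t ^ 2 := by
    have h := P (i := 0) (by norm_num) (h2.pdx.pdx.contx t)
    rw [← bb_sq hL w t] at h
    refine h.trans ?_
    gcongr
  have t7 : ∫ x in (0:ℝ)..L, (uxxtF w x t) ^ 2 ≤ 4 * (L * AA L w t) := by
    have c1 := h2.contx t
    have c2 := (hs.sm.pdx.Td 1).contx t
    have c3 := hs.sm.pdx.contx t
    have c4 := (h2.Td 1).contx t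
    have : ∫ x in (0:ℝ)..L, (uxxtF w x t) ^ 2 ≤ ∫ x in (0:ℝ)..L,
        (2 * (Td 1 (pdx w) x t * Td 0 (pdx (pdx w)) x t) ^ 2
          + 2 * (Td 0 (pdx w) x t * Td 1 (pdx (pdx w)) x t) ^ 2) := by
      apply intervalIntegral.integral_mono_on hL.le
      · exact (((c1.mul c2).add (c3.mul c4)).neg.pow 2).intervalIntegrable _ _
      · exact ((((c2.mul c1).pow 2).const_mul 2).add
          (((c3.mul c4).pow 2).const_mul 2)).intervalIntegrable _ _
      · intro x _
        show (-(pdx (pdx w) x t * Td 1 (pdx w) x t + pdx w x t * Td 1 (pdx (pdx w)) x t)) ^ 2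
          ≤ 2 * (Td 1 (pdx w) x t * pdx (pdx w) x t) ^ 2
          + 2 * (pdx w x t * Td 1 (pdx (pdx w)) x t) ^ 2
        nlinarith [sq_nonneg (pdx (pdx w) x t * Td 1 (pdx w) x t
          - pdx w x t * Td 1 (pdx (pdx w)) x t)]
    have I : ∀ {f : ℝ → ℝ}, Continuous f → IntervalIntegrable f volume 0 L :=
      fun h => h.intervalIntegrable _ _
    rw [intervalIntegral.integral_add
      (I (f := fun x => 2 * (Td 1 (pdx w) x t * Td 0 (pdx (pdx w)) x t) ^ 2)
        (((c2.mul c1).pow 2).const_mul 2))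
      (I (f := fun x => 2 * (Td 0 (pdx w) x t * Td 1 (pdx (pdx w)) x t) ^ 2)
        (((c3.mul c4).pow 2).const_mul 2)),
      intervalIntegral.integral_const_mul, intervalIntegral.integral_const_mul] at this
    have a1 := Pq (i := 1) (j := 0) (by norm_num) (by norm_num)
    have a2 := Pq (i := 0) (j := 1) (by norm_num) (by norm_num)
    linarith
  have t8 : ∫ x in (0:ℝ)..L, (pdx w x t * pdt (pdt (pdx (pdx w))) x t) ^ 2 ≤ L * AA L w t :=
    Pq (i := 0) (j := 2) (by norm_num) (by norm_num)
  have t9 : ∫ x in (0:ℝ)..L, (pdx (pdx w) x t * pdt (pdt (pdx w)) x t) ^ 2 ≤ L * AA L w t := by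
    have := Pq (i := 2) (j := 0) (by norm_num) (by norm_num)
    simp only [mul_comm (Td 2 (pdx w) _ t)] at this
    exact this
  have t10 := hs.ttt_le hL ht
  have m : aa L w 1 t ^ 2 * aa L w 2 t ^ 2 ≤ AA L w t * AA L w t := by
    gcongr <;> linarith
  have m2 := mul_le_mul_of_nonneg_left (m.trans hAA) (pow_pos hL 5).le
  have s0 : aa L w 0 t ^ 2 = ∫ x in (0:ℝ)..L, (pdx (pdx w) x t) ^ 2 := aa_sq hL w 0 t
  have s1 : aa L w 1 t ^ 2 = ∫ x in (0:ℝ)..L, (pdt (pdx (pdx w)) x t) ^ 2 := aa_sq hL w 1 t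
  have s2 : aa L w 2 t ^ 2 = ∫ x in (0:ℝ)..L, (pdt (pdt (pdx (pdx w))) x t) ^ 2 := aa_sq hL w 2 t
  have v1 : VV L w 1 t = ∫ x in (0:ℝ)..L, (pdt w x t) ^ 2 := rfl
  have v2 : VV L w 2 t = ∫ x in (0:ℝ)..L, (pdt (pdt w) x t) ^ 2 := rfl
  have v3 : VV L w 3 t = ∫ x in (0:ℝ)..L, (pdt (pdt (pdt w)) x t) ^ 2 := rfl
  have s4 := bb_sq hL w t
  unfold XX X0 X1 X2 X3
  have hLA0 : 0 ≤ L * AA L w t := by positivity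
  have hL5A0 : 0 ≤ L ^ 5 * AA L w t := by positivity
  rw [← s0, ← s1, ← s2, ← s4, ← v1, ← v2, ← v3]
  linarith

theorem Sol.X_le_F {L D k T : ℝ} {w : ℝ → ℝ → ℝ} (hs : Sol L D k T w) (hL : 0 < L) (hD : 0 < D)
    (hk : 0 < k) {t : ℝ} (ht : t ∈ Ico (0:ℝ) T) (hA1 : AA L w t ≤ 1) :
    XX L w t ≤ C3 L D k * FF L D k w t := by
  have h0 := hs.X_le hL ht hA1
  have h := hs.F_lower hL hk ht
  have h1 := VV_nonneg hL w 1 t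
  have h2 := VV_nonneg hL w 2 t
  have h3 := VV_nonneg hL w 3 t
  have h4 := ZZ_nonneg hL w t
  have hA0 := AA_nonneg L w t
  have hθ := mul_pos (tht_pos hL hD hk) hk
  have hb := sq_nonneg (bb L w t)
  have p1 := mul_nonneg hθ.le hb
  have p2 := mul_nonneg hD.le hA0
  have e1 : AA L w t ≤ 2 / D * FF L D k w t := by
    have : D / 2 * AA L w t ≤ FF L D k w t := by linarith
    rw [div_mul_eq_mul_div, le_div_iff₀ hD]; linarith
  have e2 : bb L w t ^ 2 ≤ 2 / (tht L D k * k) * FF L D k w t := by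
    rw [div_mul_eq_mul_div, le_div_iff₀ hθ]; linarith
  have f1 := mul_le_mul_of_nonneg_left e1 (show 0 ≤ 2 + 9 * L + 23 * L ^ 5 by positivity)
  have f2 := mul_le_mul_of_nonneg_left e2 (show 0 ≤ 1 + L by positivity)
  unfold C3
  linarith

noncomputable def C4 (L D k : ℝ) : ℝ :=
  4 + 9 * L ^ 5 + 2 * D + eps L k * k + tht L D k * k

theorem C4_pos {L D k : ℝ} (hL : 0 < L) (hD : 0 < D) (hk : 0 < k) : 0 < C4 L D k := by
  have := eps_pos hL hk
  have := tht_pos hL hD hk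
  unfold C4; positivity

theorem Sol.F_le_X {L D k T : ℝ} {w : ℝ → ℝ → ℝ} (hs : Sol L D k T w) (hL : 0 < L) (hD : 0 < D)
    (hk : 0 < k) {t : ℝ} (ht : t ∈ Ico (0:ℝ) T) (hX1 : XX L w t ≤ 1) :
    FF L D k w t ≤ C4 L D k * XX L w t := by
  have s0 : aa L w 0 t ^ 2 = ∫ x in (0:ℝ)..L, (pdx (pdx w) x t) ^ 2 := aa_sq hL w 0 t
  have s1 : aa L w 1 t ^ 2 = ∫ x in (0:ℝ)..L, (pdt (pdx (pdx w)) x t) ^ 2 := aa_sq hL w 1 t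
  have s2 : aa L w 2 t ^ 2 = ∫ x in (0:ℝ)..L, (pdt (pdt (pdx (pdx w))) x t) ^ 2 := aa_sq hL w 2 t
  have v1 : VV L w 1 t = ∫ x in (0:ℝ)..L, (pdt w x t) ^ 2 := rfl
  have v2 : VV L w 2 t = ∫ x in (0:ℝ)..L, (pdt (pdt w) x t) ^ 2 := rfl
  have v3 : VV L w 3 t = ∫ x in (0:ℝ)..L, (pdt (pdt (pdt w)) x t) ^ 2 := rfl
  have s4 := bb_sq hL w t
  have I : ∀ f : ℝ → ℝ, 0 ≤ ∫ x in (0:ℝ)..L, f x ^ 2 := fun f =>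
    intervalIntegral.integral_nonneg hL.le fun _ _ => sq_nonneg _
  have eX : XX L w t = X0 L w t + X1 L w t + X2 L w t + X3 L w t := rfl
  unfold X0 X1 X2 X3 at eX
  rw [← s0, ← s1, ← s2, ← s4, ← v1, ← v2, ← v3] at eX
  have i1 := I (fun x => pdx w x t * pdx (pdx w) x t)
  have i2 := I (fun x => utF w x t)
  have i3 := I (fun x => pdt (pdx w) x t * pdx (pdx w) x t)
  have i4 := I (fun x => pdx w x t * pdt (pdx (pdx w)) x t)
  have i5 := I (fun x => uttF w x t)
  have i6 := I (fun x => pdx w x t * pdx (pdx (pdx (pdx w))) x t)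
  have i7 := I (fun x => uxxtF w x t)
  have i8 := I (fun x => pdx w x t * pdt (pdt (pdx (pdx w))) x t)
  have i9 := I (fun x => pdx (pdx w) x t * pdt (pdt (pdx w)) x t)
  have i10 := I (fun x => utttF w x t)
  have n0 := sq_nonneg (aa L w 0 t)
  have n1 := sq_nonneg (aa L w 1 t)
  have n2 := sq_nonneg (aa L w 2 t)
  have n3 := sq_nonneg (bb L w t)
  have h1 := VV_nonneg hL w 1 t
  have h2 := VV_nonneg hL w 2 t
  have h3 := VV_nonneg hL w 3 t
  have hZ := hs.ZZ_le_ttt hL ht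
  have hF := hs.F_upper hL hk ht
  have hε := mul_pos (eps_pos hL hk) hk
  have hθ := mul_pos (tht_pos hL hD hk) hk
  set X := XX L w t with hX
  have hX0 : 0 ≤ X := by linarith
  have m : aa L w 1 t ^ 2 * aa L w 2 t ^ 2 ≤ X * 1 := by
    gcongr <;> linarith
  have m1 := mul_le_mul_of_nonneg_left m (pow_pos hL 5).le
  have g : ∀ {c y : ℝ}, 0 ≤ c → y ≤ X → c * y ≤ c * X := fun hc hy =>
    mul_le_mul_of_nonneg_left hy hc
  have g1 := g (c := D / 2 + eps L k * k) (y := aa L w 0 t ^ 2) (by linarith) (by linarith)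
  have g2 := g (c := D / 2) (y := aa L w 1 t ^ 2) (by linarith) (by linarith)
  have g3 := g (c := D / 2) (y := aa L w 2 t ^ 2) (by linarith) (by linarith)
  have g4 := g (c := tht L D k * k / 2) (y := bb L w t ^ 2) (by linarith) (by linarith)
  have g5 := mul_nonneg hD.le hX0
  have g6 := mul_nonneg hθ.le hX0
  unfold C4
  linarith

/-- Decay for globally smooth solutions on a slab. -/
theorem Sol.X_decay {L D k T : ℝ} {w : ℝ → ℝ → ℝ} (hs : Sol L D k T w) (hL : 0 < L)
    (hD : 0 < D) (hk : 0 < k) (h1 : XX L w 0 ≤ 1) (h2 : XX L w 0 ≤ dl L D k / (2 * C4 L D k))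
    {t : ℝ} (ht : t ∈ Ico (0:ℝ) T) :
    XX L w t ≤ C3 L D k * dl L D k * Real.exp (-om L D k * t) := by
  have h0T : (0:ℝ) ∈ Ico (0:ℝ) T := ⟨le_rfl, ht.1.trans_lt ht.2⟩
  have hδ := dl_pos hL hD hk
  have hC4 := C4_pos hL hD hk
  have hF0 : FF L D k w 0 < dl L D k := by
    have a := hs.F_le_X hL hD hk h0T h1
    have b := mul_le_mul_of_nonneg_left h2 hC4.le
    have e : C4 L D k * (dl L D k / (2 * C4 L D k)) = dl L D k / 2 := by field_simp
    linarith
  have hF := hs.F_decay hL hD hk hF0 ht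
  have hle : FF L D k w t ≤ dl L D k := by
    have := om_pos hL hD hk
    have : Real.exp (-om L D k * t) ≤ 1 := Real.exp_le_one_iff.2 (by nlinarith [ht.1])
    nlinarith
  have hX := hs.X_le_F hL hD hk ht (hs.A_le_one hL hD hk ht hle)
  have := mul_le_mul_of_nonneg_left hF (C3_pos hL hD hk).le
  linarith

/-- Agreement of two functions on an open box around `[0,L] × [0,T]`. -/
def BoxEq (L T δ : ℝ) (f g : ℝ → ℝ → ℝ) : Prop :=
  ∀ x ∈ Ioo (-δ) (L + δ), ∀ t ∈ Ioo (-δ) (T + δ), f x t = g x t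

namespace BoxEq
variable {L T δ : ℝ} {f g f' g' : ℝ → ℝ → ℝ}

theorem pdx (h : BoxEq L T δ f g) : BoxEq L T δ (pdx f) (pdx g) := by
  intro x hx t ht
  have : (fun y => f y t) =ᶠ[𝓝 x] fun y => g y t := by
    filter_upwards [isOpen_Ioo.mem_nhds hx] with y hy using h y hy t ht
  exact this.deriv_eq

theorem pdt (h : BoxEq L T δ f g) : BoxEq L T δ (pdt f) (pdt g) := by
  intro x hx t ht
  have : (fun s => f x s) =ᶠ[𝓝 t] fun s => g x s := by
    filter_upwards [isOpen_Ioo.mem_nhds ht] with s hs using h x hx s hs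
  exact this.deriv_eq

theorem int {c : ℝ} (hc : c ∈ Ioo (-δ) (L + δ)) (h : BoxEq L T δ f g) :
    BoxEq L T δ (fun x t => ∫ ξ in c..x, f ξ t) (fun x t => ∫ ξ in c..x, g ξ t) := by
  intro x hx t ht
  refine intervalIntegral.integral_congr fun y hy => ?_
  exact h y (ordConnected_Ioo.uIcc_subset hc hx hy) t ht

theorem int' {c : ℝ} (hc : c ∈ Ioo (-δ) (L + δ)) (h : BoxEq L T δ f g) :
    BoxEq L T δ (fun x t => ∫ ξ in x..c, f ξ t) (fun x t => ∫ ξ in x..c, g ξ t) := by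
  intro x hx t ht
  refine intervalIntegral.integral_congr fun y hy => ?_
  exact h y (ordConnected_Ioo.uIcc_subset hx hc hy) t ht

theorem mul (h : BoxEq L T δ f g) (h' : BoxEq L T δ f' g') :
    BoxEq L T δ (fun x t => f x t * f' x t) (fun x t => g x t * g' x t) := by
  intro x hx t ht
  simp only [h x hx t ht, h' x hx t ht]

theorem add (h : BoxEq L T δ f g) (h' : BoxEq L T δ f' g') :
    BoxEq L T δ (fun x t => f x t + f' x t) (fun x t => g x t + g' x t) := by
  intro x hx t ht
  simp only [h x hx t ht, h' x hx t ht]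

theorem neg (h : BoxEq L T δ f g) :
    BoxEq L T δ (fun x t => -f x t) (fun x t => -g x t) := by
  intro x hx t ht
  simp only [h x hx t ht]

theorem cmul (c : ℝ) (h : BoxEq L T δ f g) :
    BoxEq L T δ (fun x t => c * f x t) (fun x t => c * g x t) := by
  intro x hx t ht
  simp only [h x hx t ht]

theorem sq (h : BoxEq L T δ f g) :
    BoxEq L T δ (fun x t => f x t ^ 2) (fun x t => g x t ^ 2) := by
  intro x hx t ht
  simp only [h x hx t ht]

theorem nrm (hL : 0 < L) (hδ : 0 < δ) (h : BoxEq L T δ f g) {t : ℝ}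
    (ht : t ∈ Ioo (-δ) (T + δ)) :
    ∫ x in (0:ℝ)..L, f x t ^ 2 = ∫ x in (0:ℝ)..L, g x t ^ 2 :=
  h.sq.int (c := 0) ⟨by linarith, by linarith⟩ L ⟨by linarith, by linarith⟩ t ht

theorem utF (hL : 0 < L) (hδ : 0 < δ) (h : BoxEq L T δ f g) : BoxEq L T δ (utF f) (utF g) :=
  ((h.pdx.mul h.pdx.pdt).int (c := 0) ⟨by linarith, by linarith⟩).neg

theorem uttF (hL : 0 < L) (hδ : 0 < δ) (h : BoxEq L T δ f g) : BoxEq L T δ (uttF f) (uttF g) :=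
  ((h.pdx.pdt.sq.add (h.pdx.mul h.pdx.pdt.pdt)).int (c := 0) ⟨by linarith, by linarith⟩).neg

theorem utttF (hL : 0 < L) (hδ : 0 < δ) (h : BoxEq L T δ f g) :
    BoxEq L T δ (utttF f) (utttF g) :=
  ((((h.pdx.pdt.cmul 3).mul h.pdx.pdt.pdt).add (h.pdx.mul h.pdx.pdt.pdt.pdt)).int (c := 0)
    ⟨by linarith, by linarith⟩).neg

theorem uxxtF (h : BoxEq L T δ f g) : BoxEq L T δ (uxxtF f) (uxxtF g) :=
  ((h.pdx.pdx.mul h.pdx.pdt).add (h.pdx.mul h.pdx.pdx.pdt)).neg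

theorem XX (hL : 0 < L) (hδ : 0 < δ) (h : BoxEq L T δ f g) {t : ℝ}
    (ht : t ∈ Ioo (-δ) (T + δ)) : XX L f t = XX L g t := by
  have N := fun {f g : ℝ → ℝ → ℝ} (h : BoxEq L T δ f g) => h.nrm hL hδ ht
  unfold _root_.XX X0 X1 X2 X3
  rw [N h.pdt, N h.pdx.pdx, N (h.pdx.mul h.pdx.pdx), N (h.utF hL hδ), N h.pdt.pdt,
    N h.pdx.pdx.pdt, N (h.pdx.pdt.mul h.pdx.pdx), N (h.pdx.mul h.pdx.pdx.pdt), N (h.uttF hL hδ),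
    N h.pdx.pdx.pdx.pdx, N (h.pdx.mul h.pdx.pdx.pdx.pdx), N h.uxxtF,
    N h.pdt.pdt.pdt, N h.pdx.pdx.pdt.pdt, N (h.pdx.mul h.pdx.pdx.pdt.pdt),
    N (h.pdx.pdx.mul h.pdx.pdt.pdt), N (h.utttF hL hδ)]

end BoxEq

/-- The left-hand side of the equation of motion. -/
noncomputable def lhsF (L D k : ℝ) (w : ℝ → ℝ → ℝ) (x t : ℝ) : ℝ :=
  pdt (pdt w) x t + D * pdx (pdx (pdx (pdx w))) x t
        + k * pdx (pdx (pdx (pdx (pdt w)))) x t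
        - D * pdx (fun y s => (pdx (pdx w) y s) ^ 2 * pdx w y s) x t
        + D * pdx (pdx (fun y s => (pdx w y s) ^ 2 * pdx (pdx w) y s)) x t
        + pdx (fun y s => pdx w y s * ∫ ξ in y..L, uttF w ξ s) x t

theorem BoxEq.lhs {L T δ D k : ℝ} {f g : ℝ → ℝ → ℝ} (hL : 0 < L) (hδ : 0 < δ)
    (h : BoxEq L T δ f g) : BoxEq L T δ (lhsF L D k f) (lhsF L D k g) := by
  intro x hx t ht
  unfold lhsF
  rw [h.pdt.pdt x hx t ht, h.pdx.pdx.pdx.pdx x hx t ht, h.pdt.pdx.pdx.pdx.pdx x hx t ht,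
    (h.pdx.pdx.sq.mul h.pdx).pdx x hx t ht, (h.pdx.sq.mul h.pdx.pdx).pdx.pdx x hx t ht,
    (h.pdx.mul ((h.uttF hL hδ).int' (c := L) ⟨by linarith, by linarith⟩)).pdx x hx t ht]

theorem lhsF_eq (L D k : ℝ) {w : ℝ → ℝ → ℝ} (hw : Sm w) (x t : ℝ) :
    lhsF L D k w x t = Td 2 w x t + pdx (pdx (Mf D k w)) x t - pdx (Rf L D w) x t := by
  have a1 : pdx (pdx (pdx (pdx (pdt w)))) = Td 1 (pdx (pdx (pdx (pdx w)))) := by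
    rw [hw.comm, hw.pdx.comm, hw.pdx.pdx.comm, hw.pdx.pdx.pdx.comm]; rfl
  have a2 : pdx (fun y s => (pdx (pdx w) y s) ^ 2 * pdx w y s) x t
      = 2 * pdx w x t * pdx (pdx w) x t * pdx (pdx (pdx w)) x t + (pdx (pdx w) x t) ^ 3 := by
    have := ((hw.pdx.pdx.dx x t).pow 2).mul (hw.pdx.dx x t)
    refine (this.congr_deriv ?_).deriv
    simp; ring
  have a3 : pdx (fun y s => (pdx w y s) ^ 2 * pdx (pdx w) y s) = fun x t =>
      2 * pdx w x t * pdx (pdx w) x t * pdx (pdx w) x t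
        + (pdx w x t) ^ 2 * pdx (pdx (pdx w)) x t := by
    funext x t
    have := ((hw.pdx.dx x t).pow 2).mul (hw.pdx.pdx.dx x t)
    refine (this.congr_deriv ?_).deriv
    simp
  have a4 : pdx (pdx (fun y s => (pdx w y s) ^ 2 * pdx (pdx w) y s)) x t =
      2 * (pdx (pdx w) x t) ^ 3 + 6 * pdx w x t * pdx (pdx w) x t * pdx (pdx (pdx w)) x t
        + (pdx w x t) ^ 2 * pdx (pdx (pdx (pdx w))) x t := by
    rw [a3]
    have := ((((hw.pdx.dx x t).const_mul 2).mul (hw.pdx.pdx.dx x t)).mul (hw.pdx.pdx.dx x t)).add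
      (((hw.pdx.dx x t).pow 2).mul (hw.pdx.pdx.pdx.dx x t))
    refine (this.congr_deriv ?_).deriv
    simp; ring
  have a5 : (fun y s => pdx w y s * ∫ ξ in y..L, uttF w ξ s)
      = fun y s => pdx w y s * -(Kp L (hF w) y s) := by
    funext y s
    rw [Kp_eq L (hF_sm hw), ← intervalIntegral.integral_neg]
    rfl
  have a6 : pdx (fun y s => pdx w y s * -(Kp L (hF w) y s)) x t
      = -(pdx (pdx w) x t * Kp L (hF w) x t - pdx w x t * Jp (hF w) x t) := by
    have := (hw.pdx.dx x t).mul (Kp_dx L (hF_sm hw) x t).neg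
    refine (this.congr_deriv ?_).deriv
    simp; ring
  unfold lhsF
  rw [a1, a2, a4, a5, a6, pdx2_Mf D k hw, pdx_Rf L D hw]
  show Td 2 w x t + _ + _ - _ + _ + _ = _
  ring

theorem exists_ext {L T : ℝ} (hL : 0 < L) (hT : 0 < T) {w : ℝ → ℝ → ℝ} {U : Set (ℝ × ℝ)}
    (hU : IsOpen U) (hKU : Icc (0:ℝ) L ×ˢ Icc (0:ℝ) T ⊆ U)
    (hw : ContDiffOn ℝ (⊤ : ℕ∞) (fun q : ℝ × ℝ => w q.1 q.2) U) :
    ∃ W : ℝ → ℝ → ℝ, Sm W ∧ ∃ δ > 0, BoxEq L T δ w W := by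
  set K : Set (ℝ × ℝ) := Icc (0:ℝ) L ×ˢ Icc (0:ℝ) T with hK
  have cK : IsCompact K := isCompact_Icc.prod isCompact_Icc
  obtain ⟨χ, h0, h1, -⟩ := exists_contMDiffMap_zero_one_nhds_of_isClosed
    (n := (⊤ : ℕ∞)) (modelWithCornersSelf ℝ (ℝ × ℝ)) (s := Uᶜ) (t := K) hU.isClosed_compl cK.isClosed
    (by rw [disjoint_compl_left_iff_subset]; exact hKU)
  have hχ : ContDiff ℝ ∞ (fun q => χ q) := χ.contMDiff.contDiff
  obtain ⟨V, hV, hKV, hV1⟩ := mem_nhdsSet_iff_exists.1 h1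
  obtain ⟨δ, hδ, hδV⟩ := cK.exists_thickening_subset_open hV hKV
  refine ⟨fun x t => χ (x, t) * w x t, ?_, δ, hδ, ?_⟩
  · refine contDiff_iff_contDiffAt.2 fun q => ?_
    by_cases hq : q ∈ U
    · exact hχ.contDiffAt.mul ((hw q hq).contDiffAt (hU.mem_nhds hq))
    · have := (eventually_nhdsSet_iff_forall.1 h0) q hq
      refine (contDiffAt_const (c := (0:ℝ))).congr_of_eventuallyEq ?_
      filter_upwards [this] with p hp
      show χ (p.1, p.2) * _ = 0
      rw [hp, zero_mul]
  · intro x hx t ht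
    have : (x, t) ∈ V := by
      apply hδV
      rw [Metric.mem_thickening_iff]
      refine ⟨(max 0 (min x L), max 0 (min t T)), ⟨⟨by simp, by simp [hL.le]⟩, ⟨by simp, by simp [hT.le]⟩⟩, ?_⟩
      rw [Prod.dist_eq, max_lt_iff, Real.dist_eq, Real.dist_eq, abs_lt, abs_lt]
      obtain ⟨b1, b2⟩ := hx
      obtain ⟨b3, b4⟩ := ht
      refine ⟨⟨?_, ?_⟩, ⟨?_, ?_⟩⟩ <;> dsimp only <;> grind
    show w x t = χ (x, t) * w x t
    rw [show χ (x, t) = 1 from hV1 this, one_mul]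

end

theorem global_exponential_decay
    (L D k2 : ℝ) (hL : 0 < L) (hD : 0 < D) (hk2 : 0 < k2) :
    ∃ Q M ω : ℝ, 0 < Q ∧ 0 < M ∧ 0 < ω ∧
      ∀ w : ℝ → ℝ → ℝ,
        (∃ U : Set (ℝ × ℝ), IsOpen U ∧ Icc (0:ℝ) L ×ˢ Ici (0:ℝ) ⊆ U ∧
          ContDiffOn ℝ (⊤ : ℕ∞) (fun q : ℝ × ℝ => w q.1 q.2) U) →
        (∀ T : ℝ, 0 < T → IsFullSol L D k2 T (fun _ _ => 0) w) →
        X0 L w 0 + X1 L w 0 + X2 L w 0 + X3 L w 0 ≤ Q →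
        ∀ t : ℝ, 0 ≤ t →
          X0 L w t + X1 L w t + X2 L w t + X3 L w t ≤ M * Real.exp (-ω * t) := by
  have hδ := dl_pos hL hD hk2
  have hC4 := C4_pos hL hD hk2
  have hC3 := C3_pos hL hD hk2
  refine ⟨min 1 (dl L D k2 / (2 * C4 L D k2)), C3 L D k2 * dl L D k2, om L D k2,
    lt_min one_pos (by positivity), by positivity, om_pos hL hD hk2, ?_⟩
  rintro w ⟨U, hU, hKU, hw⟩ hsol hX t ht
  have hT : 0 < t + 1 := by linarith
  obtain ⟨-, pde, bc⟩ := hsol (t + 1) hT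
  obtain ⟨W, hW, δ, hδ0, hE⟩ := exists_ext hL hT hU
    (Subset.trans (prod_mono Subset.rfl Icc_subset_Ici_self) hKU) hw
  have hx0 : (0:ℝ) ∈ Ioo (-δ) (L + δ) := ⟨by linarith, by linarith⟩
  have hxL : L ∈ Ioo (-δ) (L + δ) := ⟨by linarith, by linarith⟩
  have hti : ∀ {s : ℝ}, s ∈ Ioo (0:ℝ) (t + 1) → s ∈ Ioo (-δ) (t + 1 + δ) := fun hs =>
    ⟨by linarith [hs.1], by linarith [hs.2]⟩
  have hS : Sol L D k2 (t + 1) W :=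
    { sm := hW
      pde := by
        intro x hx s hs
        rw [← lhsF_eq L D k2 hW, ← hE.lhs hL hδ0 x ⟨by linarith [hx.1], by linarith [hx.2]⟩ s
          (hti hs)]
        exact pde x hx s (Ioo_subset_Icc_self hs)
      bc1 := fun s hs => by
        rw [← hE 0 hx0 s (hti hs)]; exact (bc s (Ioo_subset_Icc_self hs)).1
      bc2 := fun s hs => by
        rw [← hE.pdx 0 hx0 s (hti hs)]; exact (bc s (Ioo_subset_Icc_self hs)).2.1
      bc3 := fun s hs => by
        rw [← hE.pdx.pdx L hxL s (hti hs)]; exact (bc s (Ioo_subset_Icc_self hs)).2.2.1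
      bc4 := fun s hs => by
        rw [← hE.pdx.pdx.pdx L hxL s (hti hs)]; exact (bc s (Ioo_subset_Icc_self hs)).2.2.2 }
  have e0 : XX L w 0 = XX L W 0 := hE.XX hL hδ0 ⟨by linarith, by linarith⟩
  have e1 : XX L w t = XX L W t := hE.XX hL hδ0 ⟨by linarith, by linarith⟩
  change XX L w 0 ≤ _ at hX
  change XX L w t ≤ _
  rw [e0] at hX
  rw [e1]
  exact hS.X_decay hL hD hk2 (hX.trans (min_le_left _ _)) (hX.trans (min_le_right _ _))
    ⟨ht, by linarith⟩
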